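/- arXiv:1507.08483 — 3 statements merged into one kernel-verified Lean document; each statement's English description precedes it below -/
import Mathlib

section
/- (Theorem 1) For every integer n ≥ 3 there exist a finite-dimensional ℚ-vector space V with dim_ℚ V = n(n²+5)/6 and a representation ρ : Out(F_n) → GL(V) that does not factor through GL(n,ℤ), i.e. there is no group homomorphism σ : Aut(F_n^{ab}) → GL(V) with ρ = σ∘π. -/
/-- The subgroup of inner automorphisms of a group `G`. -/
def innerAuts (G : Type*) [Group G] : Subgroup (MulAut G) := (MulAut.conj (G := G)).range

instance innerAuts_normal (G : Type*) [Group G] : (innerAuts G).Normal := by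
  constructor
  intro a ha φ
  obtain ⟨g, rfl⟩ := MonoidHom.mem_range.mp ha
  refine MonoidHom.mem_range.mpr ⟨φ g, ?_⟩
  ext x
  simp [MulAut.conj, mul_assoc]

/-- The outer automorphism group `Out(G) = Aut(G)/Inn(G)`. -/
def OutGrp (G : Type*) [Group G] := MulAut G ⧸ innerAuts G

instance (G : Type*) [Group G] : Group (OutGrp G) :=
  inferInstanceAs (Group (MulAut G ⧸ innerAuts G))

/-- The homomorphism `Aut(G) → Aut(G^{ab})` given by functoriality of abelianization. -/
def autToAbAut (G : Type*) [Group G] : MulAut G →* MulAut (Abelianization G) where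
  toFun e := e.abelianizationCongr
  map_one' := by
    ext x
    exact DFunLike.congr_fun abelianizationCongr_refl x
  map_mul' e₁ e₂ := by
    ext x
    exact (DFunLike.congr_fun (abelianizationCongr_trans e₂ e₁) x).symm

/-- Inner automorphisms act trivially on the abelianization, hence the canonical
homomorphism `π : Out(G) → Aut(G^{ab})`. -/
def outToAbAut (G : Type*) [Group G] : OutGrp G →* MulAut (Abelianization G) :=
  QuotientGroup.lift (innerAuts G) (autToAbAut G) (by
    intro a ha
    obtain ⟨g, rfl⟩ := MonoidHom.mem_range.mp ha
    apply MulEquiv.toMonoidHom_injective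
    apply Abelianization.hom_ext
    ext x
    show Abelianization.of (MulAut.conj g x) = Abelianization.of x
    simp [MulAut.conj, mul_comm, mul_assoc, mul_left_comm])

namespace OutRep

open Matrix

/-- skew-symmetric matrices -/
def Sk (n : ℕ) : Submodule ℚ (Matrix (Fin n) (Fin n) ℚ) where
  carrier := {M | Mᵀ = -M}
  add_mem' := by
    intro a b ha hb
    simp only [Set.mem_ofPred_eq] at *
    rw [transpose_add, ha, hb]; abel
  zero_mem' := by simp
  smul_mem' := by
    intro c a ha
    simp only [Set.mem_ofPred_eq] at *
    rw [transpose_smul, ha, smul_neg]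

abbrev H (n : ℕ) := Fin n → ℚ

/-- wedge product -/
def wd {n : ℕ} (x y : H n) : Sk n :=
  ⟨vecMulVec x y - vecMulVec y x, by
    change (_ : Matrix _ _ ℚ)ᵀ = - _
    rw [transpose_sub, transpose_vecMulVec, transpose_vecMulVec]; abel⟩

lemma wd_coe {n : ℕ} (x y : H n) : (wd x y : Matrix _ _ ℚ) = vecMulVec x y - vecMulVec y x := rfl

lemma wd_add_left {n : ℕ} (x x' y : H n) : wd (x + x') y = wd x y + wd x' y := by
  ext i j; simp [wd_coe, vecMulVec_apply]; ring
lemma wd_add_right {n : ℕ} (x y y' : H n) : wd x (y + y') = wd x y + wd x y' := by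
  ext i j; simp [wd_coe, vecMulVec_apply]; ring
lemma wd_neg_left {n : ℕ} (x y : H n) : wd (-x) y = - wd x y := by
  ext i j; simp [wd_coe, vecMulVec_apply]; ring
lemma wd_neg_right {n : ℕ} (x y : H n) : wd x (-y) = - wd x y := by
  ext i j; simp [wd_coe, vecMulVec_apply]; ring
lemma wd_smul_left {n : ℕ} (c : ℚ) (x y : H n) : wd (c • x) y = c • wd x y := by
  ext i j; simp [wd_coe, vecMulVec_apply]; ring
lemma wd_smul_right {n : ℕ} (c : ℚ) (x y : H n) : wd x (c • y) = c • wd x y := by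
  ext i j; simp [wd_coe, vecMulVec_apply]; ring
lemma wd_self {n : ℕ} (x : H n) : wd x x = 0 := by
  ext i j; simp [wd_coe, vecMulVec_apply]
lemma wd_swap {n : ℕ} (x y : H n) : wd x y = - wd y x := by
  ext i j; simp [wd_coe, vecMulVec_apply]
lemma wd_zero_left {n : ℕ} (y : H n) : wd 0 y = 0 := by
  ext i j; simp [wd_coe, vecMulVec_apply]
lemma wd_zero_right {n : ℕ} (y : H n) : wd y 0 = 0 := by
  ext i j; simp [wd_coe, vecMulVec_apply]

/-- congruence action -/
def act {n : ℕ} (A : Matrix (Fin n) (Fin n) ℚ) : Sk n →ₗ[ℚ] Sk n where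
  toFun M := ⟨A * M.1 * Aᵀ, by
    have h : M.1ᵀ = - M.1 := M.2
    change (_ : Matrix _ _ ℚ)ᵀ = - _
    rw [transpose_mul, transpose_mul, h, transpose_transpose]
    simp [Matrix.mul_assoc]⟩
  map_add' M N := by
    apply Subtype.ext
    simp [Matrix.mul_add, Matrix.add_mul]
  map_smul' c M := by
    apply Subtype.ext
    simp

lemma act_coe {n : ℕ} (A : Matrix (Fin n) (Fin n) ℚ) (M : Sk n) :
    (act A M : Matrix _ _ ℚ) = A * M.1 * Aᵀ := rfl

lemma act_one {n : ℕ} (M : Sk n) : act 1 M = M := by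
  apply Subtype.ext; simp [act_coe]

lemma act_mul {n : ℕ} (A B : Matrix (Fin n) (Fin n) ℚ) (M : Sk n) :
    act (A * B) M = act A (act B M) := by
  apply Subtype.ext; simp [act_coe, Matrix.mul_assoc]

lemma act_wd {n : ℕ} (A : Matrix (Fin n) (Fin n) ℚ) (x y : H n) :
    act A (wd x y) = wd (A *ᵥ x) (A *ᵥ y) := by
  apply Subtype.ext
  simp only [act_coe, wd_coe, Matrix.mul_sub, Matrix.sub_mul, mul_vecMulVec, vecMulVec_mul,
    vecMul_transpose]

/-- Heisenberg group -/
@[ext] structure Hs (n : ℕ) where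
  a : H n
  b : Sk n

instance (n : ℕ) : Mul (Hs n) := ⟨fun p q => ⟨p.a + q.a, p.b + q.b + wd p.a q.a⟩⟩
instance (n : ℕ) : One (Hs n) := ⟨⟨0, 0⟩⟩
instance (n : ℕ) : Inv (Hs n) := ⟨fun p => ⟨-p.a, -p.b⟩⟩

lemma mul_a {n : ℕ} (p q : Hs n) : (p * q).a = p.a + q.a := rfl
lemma mul_b {n : ℕ} (p q : Hs n) : (p * q).b = p.b + q.b + wd p.a q.a := rfl
lemma one_a {n : ℕ} : (1 : Hs n).a = 0 := rfl
lemma one_b {n : ℕ} : (1 : Hs n).b = 0 := rfl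
lemma inv_a {n : ℕ} (p : Hs n) : (p⁻¹).a = -p.a := rfl
lemma inv_b {n : ℕ} (p : Hs n) : (p⁻¹).b = -p.b := rfl

instance (n : ℕ) : Group (Hs n) := Group.ofLeftAxioms
  (by
    intro p q r
    apply Hs.ext
    · simp only [mul_a]; abel
    · simp only [mul_a, mul_b, wd_add_left, wd_add_right]; abel)
  (by
    intro p
    apply Hs.ext
    · simp only [mul_a, one_a]; abel
    · simp only [mul_b, one_a, one_b, wd_zero_left]; abel)
  (by
    intro p
    apply Hs.ext
    · simp only [mul_a, inv_a, one_a]; abel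
    · simp only [mul_b, inv_a, inv_b, one_b, wd_neg_left, wd_self]; abel)

def e {n : ℕ} (i : Fin n) : H n := Pi.single i 1

/-- expansion -/
def Th (n : ℕ) : FreeGroup (Fin n) →* Hs n := FreeGroup.lift (fun i => ⟨e i, 0⟩)

lemma Th_of {n : ℕ} (i : Fin n) : Th n (FreeGroup.of i) = ⟨e i, 0⟩ := by simp [Th]

abbrev F (n : ℕ) := FreeGroup (Fin n)

def A {n : ℕ} (φ : MulAut (F n)) : Matrix (Fin n) (Fin n) ℚ :=
  Matrix.of fun j i => (Th n (φ (FreeGroup.of i))).a j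

lemma A_e {n : ℕ} (φ : MulAut (F n)) (i : Fin n) :
    A φ *ᵥ e i = (Th n (φ (FreeGroup.of i))).a := by
  ext j
  simp [A, e]

lemma A_a {n : ℕ} (φ : MulAut (F n)) (g : F n) : A φ *ᵥ (Th n g).a = (Th n (φ g)).a := by
  induction g using FreeGroup.induction_on with
  | C1 => simp [one_a]
  | of i => rw [Th_of, A_e]
  | inv_of i h => simp only [map_inv, inv_a, mulVec_neg, h]
  | mul x y hx hy => simp only [map_mul, mul_a, mulVec_add, hx, hy]

lemma ext_e {n : ℕ} {M N : Matrix (Fin n) (Fin n) ℚ} (h : ∀ i, M *ᵥ e i = N *ᵥ e i) : M = N := by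
  ext j i
  have := congrFun (h i) j
  simpa [e] using this

lemma A_one {n : ℕ} : A (1 : MulAut (F n)) = 1 :=
  ext_e fun i => by rw [A_e]; simp [Th_of]

lemma A_mul {n : ℕ} (φ χ : MulAut (F n)) : A (φ * χ) = A φ * A χ :=
  ext_e fun i => by rw [A_e, ← mulVec_mulVec, A_e, A_a]; rfl

/-- the cocycle -/
def k {n : ℕ} (φ : MulAut (F n)) : H n →ₗ[ℚ] Sk n :=
  Fintype.linearCombination ℚ (fun i => (Th n (φ (FreeGroup.of i))).b)

lemma k_e {n : ℕ} (φ : MulAut (F n)) (i : Fin n) :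
    k φ (e i) = (Th n (φ (FreeGroup.of i))).b := by
  simp [k, e]

lemma k_a {n : ℕ} (φ : MulAut (F n)) (g : F n) :
    k φ (Th n g).a = (Th n (φ g)).b - act (A φ) (Th n g).b := by
  induction g using FreeGroup.induction_on with
  | C1 => simp [one_a, one_b]
  | of i => rw [Th_of, k_e]; simp
  | inv_of i h => simp only [map_inv, inv_a, inv_b, map_neg, h]; abel
  | mul x y hx hy =>
    simp only [map_mul, mul_a, mul_b, map_add, hx, hy, act_wd, A_a]; abel

lemma lin_ext {n : ℕ} {M : Type*} [AddCommGroup M] [Module ℚ M] {f g : H n →ₗ[ℚ] M}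
    (h : ∀ i, f (e i) = g (e i)) : f = g := by
  apply LinearMap.pi_ext'
  intro i
  ext
  exact h i

lemma k_one {n : ℕ} : k (1 : MulAut (F n)) = 0 :=
  lin_ext fun i => by rw [k_e]; simp [Th_of]

lemma k_mul {n : ℕ} (φ χ : MulAut (F n)) (h : H n) :
    k (φ * χ) h = k φ (A χ *ᵥ h) + act (A φ) (k χ h) := by
  have : k (φ * χ) = k φ ∘ₗ (A χ).mulVecLin + act (A φ) ∘ₗ k χ := lin_ext fun i => by
    simp only [LinearMap.add_apply, LinearMap.comp_apply, mulVecLin_apply]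
    rw [k_e, k_e, A_e, k_a]
    simp
  rw [this]; rfl

/-- contraction -/
def tr {n : ℕ} (f : H n →ₗ[ℚ] Sk n) : H n := ∑ i, (f (e i)).1 *ᵥ e i

lemma tr_add {n : ℕ} (f g : H n →ₗ[ℚ] Sk n) : tr (f + g) = tr f + tr g := by
  simp [tr, add_mulVec, Finset.sum_add_distrib]

lemma expand {n : ℕ} (h : H n) : h = ∑ j, h j • e j := by
  ext i; simp [e, Finset.sum_apply, Pi.single_apply]

lemma tr_act {n : ℕ} (P Q : Matrix (Fin n) (Fin n) ℚ) (hQ : Q * P = 1)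
    (f : H n →ₗ[ℚ] Sk n) :
    tr (act P ∘ₗ f ∘ₗ Q.mulVecLin) = P *ᵥ tr f := by
  have h1 : ∀ i, ((act P ∘ₗ f ∘ₗ Q.mulVecLin) (e i)).1 *ᵥ e i =
      ∑ j, P *ᵥ ((f (e j)).1 *ᵥ (Pᵀ *ᵥ (Q j i • e i))) := by
    intro i
    simp only [LinearMap.comp_apply, mulVecLin_apply]
    rw [expand (Q *ᵥ e i)]
    simp only [map_sum, map_smul]
    rw [AddSubmonoidClass.coe_finsetSum, Matrix.sum_mulVec]
    refine Finset.sum_congr rfl fun j _ => ?_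
    have : (Q *ᵥ e i) j = Q j i := by simp [e]
    rw [this, mulVec_smul, mulVec_smul, mulVec_smul]
    simp only [Submodule.coe_smul, act_coe, smul_mulVec, mulVec_mulVec, Matrix.mul_assoc]
  unfold tr
  rw [Finset.sum_congr rfl fun i _ => h1 i, Finset.sum_comm, Matrix.mulVec_sum]
  refine Finset.sum_congr rfl fun j _ => ?_
  rw [← Matrix.mulVec_sum, ← Matrix.mulVec_sum, ← Matrix.mulVec_sum]
  have h2 : ∑ i, Q j i • e i = Qᵀ *ᵥ e j := by
    conv_rhs => rw [expand (Qᵀ *ᵥ e j)]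
    refine Finset.sum_congr rfl fun i _ => ?_
    simp [e]
  have h3 : Pᵀ *ᵥ (Qᵀ *ᵥ e j) = e j := by
    rw [mulVec_mulVec, ← transpose_mul, hQ]; simp
  rw [h2, h3]

def c {n : ℕ} (φ : MulAut (F n)) : H n := tr (k φ ∘ₗ (A φ⁻¹).mulVecLin)

lemma A_inv_mul {n : ℕ} (φ : MulAut (F n)) : A φ⁻¹ * A φ = 1 := by
  rw [← A_mul, inv_mul_cancel, A_one]
lemma A_mul_inv {n : ℕ} (φ : MulAut (F n)) : A φ * A φ⁻¹ = 1 := by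
  rw [← A_mul, mul_inv_cancel, A_one]

lemma c_mul {n : ℕ} (φ χ : MulAut (F n)) : c (φ * χ) = c φ + A φ *ᵥ c χ := by
  unfold c
  rw [← tr_act (A φ) (A φ⁻¹) (A_inv_mul φ), ← tr_add]
  congr 1
  ext1 i
  ext1
  simp only [LinearMap.comp_apply, LinearMap.add_apply, mulVecLin_apply]
  rw [k_mul, _root_.mul_inv_rev, A_mul, mulVec_mulVec, mulVec_mulVec, ← Matrix.mul_assoc, A_mul_inv,
    Matrix.one_mul]

lemma c_one {n : ℕ} : c (1 : MulAut (F n)) = 0 := by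
  unfold c; rw [k_one]; simp [tr]

def wdL {n : ℕ} (x : H n) : H n →ₗ[ℚ] Sk n where
  toFun := wd x
  map_add' := wd_add_right x
  map_smul' c y := wd_smul_right c x y

lemma tr_wdL {n : ℕ} (x : H n) : tr (wdL x) = ((n : ℚ) - 1) • x := by
  ext j
  simp [tr, wdL, wd_coe, sub_mulVec, vecMulVec_apply, e, Finset.sum_apply, Pi.single_apply]
  ring

/-- the representation of Aut -/
def R {n : ℕ} (φ : MulAut (F n)) : (H n × Sk n) →ₗ[ℚ] (H n × Sk n) :=
  LinearMap.prod ((A φ).mulVecLin ∘ₗ LinearMap.fst ℚ _ _)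
    (act (A φ) ∘ₗ LinearMap.snd ℚ _ _ +
      (k φ - ((n : ℚ) - 1)⁻¹ • wdL (c φ) ∘ₗ (A φ).mulVecLin) ∘ₗ LinearMap.fst ℚ _ _)

lemma R_apply {n : ℕ} (φ : MulAut (F n)) (v : H n × Sk n) :
    R φ v = (A φ *ᵥ v.1, act (A φ) v.2 + (k φ v.1 - ((n : ℚ) - 1)⁻¹ • wd (c φ) (A φ *ᵥ v.1))) :=
  rfl

def RR (n : ℕ) : MulAut (F n) →* Module.End ℚ (H n × Sk n) where
  toFun := R
  map_one' := by
    refine LinearMap.ext fun v => ?_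
    rw [R_apply, A_one, k_one, c_one, wd_zero_left, act_one]
    simp
  map_mul' φ χ := by
    refine LinearMap.ext fun v => ?_
    rw [Module.End.mul_apply, R_apply, R_apply, R_apply, A_mul, k_mul, c_mul]
    simp only [act_mul, wd_add_left, map_add, map_sub, map_smul, act_wd, mulVec_mulVec]
    refine Prod.ext rfl ?_
    simp only [smul_add]
    abel

lemma Th_conj {n : ℕ} (g x : F n) : Th n (MulAut.conj g x) =
    ⟨(Th n x).a, (Th n x).b + (2 : ℚ) • wd (Th n g).a (Th n x).a⟩ := by
  simp only [MulAut.conj_apply, map_mul, map_inv]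
  apply Hs.ext
  · simp only [mul_a, inv_a]; abel
  · simp only [mul_b, mul_a, inv_a, inv_b, wd_add_left, wd_neg_right, wd_self, two_smul]
    rw [wd_swap (Th n x).a]; abel

lemma A_conj {n : ℕ} (g : F n) : A (MulAut.conj g) = 1 :=
  ext_e fun i => by rw [A_e, Th_conj, Th_of]; simp

lemma k_conj {n : ℕ} (g : F n) : k (MulAut.conj g) = wdL ((2 : ℚ) • (Th n g).a) :=
  lin_ext fun i => by
    rw [k_e, Th_conj, Th_of]
    simp [wdL, wd_smul_left]

lemma R_conj {n : ℕ} (hn : 3 ≤ n) (g : F n) : R (MulAut.conj g) = 1 := by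
  have hn' : (n : ℚ) - 1 ≠ 0 := by
    have : (3 : ℚ) ≤ n := by exact_mod_cast hn
    linarith
  have hc : c (MulAut.conj g) = ((n : ℚ) - 1) • ((2 : ℚ) • (Th n g).a) := by
    unfold c
    rw [← map_inv, A_conj, k_conj, ← tr_wdL]
    simp
  refine LinearMap.ext fun v => ?_
  rw [R_apply, hc, k_conj, A_conj, wd_smul_left, smul_smul, inv_mul_cancel₀ hn', act_one]
  simp [wdL]

/-- the transvection-like map -/
def tHom {n : ℕ} (i : Fin n) (w : F n) : F n →* F n :=
  FreeGroup.lift fun j => if j = i then FreeGroup.of j * w else FreeGroup.of j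

lemma tHom_of {n : ℕ} (i : Fin n) (w : F n) (j : Fin n) :
    tHom i w (FreeGroup.of j) = if j = i then FreeGroup.of j * w else FreeGroup.of j := by
  simp [tHom]

open scoped commutatorElement in
def cm {n : ℕ} (p q : Fin n) : F n := ⁅FreeGroup.of p, FreeGroup.of q⁆

lemma tHom_cm {n : ℕ} {i p q : Fin n} (hp : p ≠ i) (hq : q ≠ i) (w : F n) :
    tHom i w (cm p q) = cm p q := by
  simp [cm, commutatorElement_def, tHom_of, hp, hq]

def tAut {n : ℕ} (i p q : Fin n) (hp : p ≠ i) (hq : q ≠ i) : MulAut (F n) :=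
  MonoidHom.toMulEquiv (tHom i (cm p q)) (tHom i (cm p q)⁻¹)
    (by
      apply FreeGroup.ext_hom
      intro j
      by_cases h : j = i
      · simp [tHom_of, h, tHom_cm hp hq]
      · simp [tHom_of, h])
    (by
      apply FreeGroup.ext_hom
      intro j
      by_cases h : j = i
      · simp [tHom_of, h, tHom_cm hp hq]
      · simp [tHom_of, h])

lemma tAut_of {n : ℕ} (i p q : Fin n) (hp : p ≠ i) (hq : q ≠ i) (j : Fin n) :
    tAut i p q hp hq (FreeGroup.of j) =
      if j = i then FreeGroup.of j * cm p q else FreeGroup.of j := tHom_of _ _ _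

lemma tAut_ab {n : ℕ} (i p q : Fin n) (hp : p ≠ i) (hq : q ≠ i) :
    autToAbAut (F n) (tAut i p q hp hq) = 1 := by
  apply MulEquiv.toMonoidHom_injective
  apply Abelianization.hom_ext
  apply FreeGroup.ext_hom
  intro j
  change Abelianization.of (tAut i p q hp hq (FreeGroup.of j)) = Abelianization.of (FreeGroup.of j)
  rw [tAut_of]
  split_ifs
  · simp [cm, commutatorElement_def]
  · rfl

lemma Th_cm {n : ℕ} (p q : Fin n) : Th n (cm p q) = ⟨0, (2 : ℚ) • wd (e p) (e q)⟩ := by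
  simp only [cm, commutatorElement_def, map_mul, map_inv, Th_of]
  apply Hs.ext
  · simp only [mul_a, inv_a]; abel
  · simp only [mul_b, mul_a, inv_a, inv_b, wd_add_left, wd_neg_left, wd_neg_right, wd_self,
      two_smul]
    rw [wd_swap (e q) (e p)]; abel

lemma R_tAut {n : ℕ} (i p q : Fin n) (hp : p ≠ i) (hq : q ≠ i) (hpq : p ≠ q) :
    R (tAut i p q hp hq) ≠ 1 := by
  intro h
  have h1 := congrArg (fun f => ((f (e i, 0)).2 : Sk n).1 p q) h
  have h2 : Th n (tAut i p q hp hq (FreeGroup.of i)) = ⟨e i, (2 : ℚ) • wd (e p) (e q)⟩ := by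
    rw [tAut_of, if_pos rfl, map_mul, Th_cm, Th_of]
    apply Hs.ext
    · simp [mul_a]
    · simp [mul_b, wd_zero_right]
  simp only [R_apply, A_e, k_e, h2] at h1
  simp [wd_coe, vecMulVec_apply, e, hp, hq, hpq] at h1

lemma finrank_Sk (n : ℕ) : Module.finrank ℚ (Sk n) ≤ n * (n - 1) / 2 := by
  let f : Sk n →ₗ[ℚ] ((Σ i : Fin n, Fin i) → ℚ) :=
    { toFun := fun M s => M.1 s.1 ⟨s.2, s.2.2.trans s.1.2⟩
      map_add' := fun _ _ => rfl
      map_smul' := fun _ _ => rfl }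
  have hf : Function.Injective f := by
    rw [← LinearMap.ker_eq_bot, LinearMap.ker_eq_bot']
    intro M hM
    have hs : ∀ i j, M.1 j i = - M.1 i j := fun i j => congrFun (congrFun (M.2 : M.1ᵀ = -M.1) i) j
    have hl : ∀ i j : Fin n, j < i → M.1 i j = 0 := fun i j hij => congrFun hM ⟨i, ⟨j, hij⟩⟩
    apply Subtype.ext
    ext i j
    rcases lt_trichotomy i j with h | h | h
    · rw [hs j i, hl j i h]; simp
    · subst h
      have := hs i i
      have : M.1 i i = 0 := by linarith
      simpa using this
    · simpa using hl i j h
  have := LinearMap.finrank_le_finrank_of_injective hf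
  rw [Module.finrank_fintype_fun_eq_card, Fintype.card_sigma] at this
  simp only [Fintype.card_fin] at this
  rwa [Fin.sum_univ_eq_sum_range (fun i => i), Finset.sum_range_id] at this

lemma dim_le (n : ℕ) (hn : 3 ≤ n) : Module.finrank ℚ (H n × Sk n) ≤ n * (n ^ 2 + 5) / 6 := by
  have h := finrank_Sk n
  rw [Module.finrank_prod, Module.finrank_fintype_fun_eq_card, Fintype.card_fin]
  have h2 : 2 * Module.finrank ℚ (Sk n) ≤ n * (n - 1) := by omega
  obtain ⟨m, rfl⟩ := Nat.exists_eq_add_of_le hn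
  rw [Nat.le_div_iff_mul_le (by norm_num)]
  have h3 : 3 + m - 1 = m + 2 := by omega
  rw [h3] at h2
  nlinarith [Nat.zero_le m, Nat.zero_le (m ^ 2), Nat.zero_le (m ^ 3)]

/-- padding by a trivial representation -/
def pad (V W : Type) [AddCommGroup V] [Module ℚ V] [AddCommGroup W] [Module ℚ W] :
    Module.End ℚ V →* Module.End ℚ (V × W) where
  toFun f := LinearMap.prodMap f LinearMap.id
  map_one' := rfl
  map_mul' _ _ := rfl

end OutRep

/-- (Theorem 1.) For every `n ≥ 3` there is a representation of
`Out(F_n)` over `ℚ` of dimension `n(n²+5)/6` that does not factor through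
`GL(n,ℤ) ≅ Aut(F_n^{ab})`, i.e. not of the form `σ ∘ π` with
`π : Out(F_n) → Aut(F_n^{ab})` the canonical map. -/
theorem stmt_0 : ∀ n : ℕ, 3 ≤ n →
    ∃ (V : Type) (_ : AddCommGroup V) (_ : Module ℚ V),
      FiniteDimensional ℚ V ∧
      Module.finrank ℚ V = n * (n ^ 2 + 5) / 6 ∧
      ∃ ρ : OutGrp (FreeGroup (Fin n)) →* LinearMap.GeneralLinearGroup ℚ V,
        ¬ ∃ σ : MulAut (Abelianization (FreeGroup (Fin n))) →*
              LinearMap.GeneralLinearGroup ℚ V,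
            ρ = σ.comp (outToAbAut (FreeGroup (Fin n))) := by
  intro n hn
  obtain ⟨m, hm⟩ := Nat.exists_eq_add_of_le (OutRep.dim_le n hn)
  let i : Fin n := ⟨0, by omega⟩
  let p : Fin n := ⟨1, by omega⟩
  let q : Fin n := ⟨2, by omega⟩
  have hp : p ≠ i := by simp [p, i]
  have hq : q ≠ i := by simp [q, i]
  have hpq : p ≠ q := by simp [p, q]
  let ρ₀ : MulAut (FreeGroup (Fin n)) →*
      LinearMap.GeneralLinearGroup ℚ ((OutRep.H n × OutRep.Sk n) × (Fin m → ℚ)) :=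
    ((OutRep.pad (OutRep.H n × OutRep.Sk n) (Fin m → ℚ)).comp (OutRep.RR n)).toHomUnits
  have hρ : ∀ φ ∈ innerAuts (FreeGroup (Fin n)), ρ₀ φ = 1 := by
    intro φ hφ
    obtain ⟨g, rfl⟩ := MonoidHom.mem_range.mp hφ
    apply Units.ext
    change OutRep.pad _ _ (OutRep.R (MulAut.conj g)) = 1
    rw [OutRep.R_conj hn, map_one]
  refine ⟨(OutRep.H n × OutRep.Sk n) × (Fin m → ℚ), inferInstance, inferInstance, inferInstance,
    ?_, QuotientGroup.lift (innerAuts (FreeGroup (Fin n))) ρ₀ hρ, ?_⟩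
  · rw [Module.finrank_prod, hm, Module.finrank_fintype_fun_eq_card, Fintype.card_fin]
  · rintro ⟨σ, hσ⟩
    have h1 : ρ₀ (OutRep.tAut i p q hp hq) =
        σ (autToAbAut (FreeGroup (Fin n)) (OutRep.tAut i p q hp hq)) :=
      DFunLike.congr_fun hσ (QuotientGroup.mk (OutRep.tAut i p q hp hq))
    rw [OutRep.tAut_ab, map_one] at h1
    apply OutRep.R_tAut i p q hp hq hpq
    refine LinearMap.ext fun v => ?_
    have h2 := congrArg (fun u : LinearMap.GeneralLinearGroup ℚ
      ((OutRep.H n × OutRep.Sk n) × (Fin m → ℚ)) => (u.1 (v, 0)).1) h1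
    exact h2
end

section
/- (Theorem 1 refined by the Hodge filtration) For every integer n ≥ 3 there exist a finite-dimensional ℚ-vector space V with dim_ℚ V = n(n²+5)/6, a representation ρ : Out(F_n) → GL(V) that does not factor through GL(n,ℤ), and a ρ-invariant subspace W ⊆ V with dim_ℚ W = n(n+1)/2 and dim_ℚ (V/W) = binomial(n,3), such that the induced representations of Out(F_n) on W and on V/W both factor through GL(n,ℤ) (i.e. through π). In particular ρ is a nontrivial extension of two representations that factor through GL(n,ℤ). -/
section QFE

variable {G H : Type} [Group G] [Group H]

/-- Solutions of the quadratic functional equation on `G`. -/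
def QV (G : Type) [Group G] : Submodule ℚ (G → ℚ) where
  carrier := {f | ∀ u v : G, f (u * v) + f (u * v⁻¹) = 2 * f u + 2 * f v}
  add_mem' := by
    intro f g hf hg u v
    have h1 := hf u v
    have h2 := hg u v
    simp only [Pi.add_apply]
    linarith
  zero_mem' := by intro u v; simp
  smul_mem' := by
    intro c f hf u v
    have h1 := hf u v
    simp only [Pi.smul_apply, smul_eq_mul]
    linear_combination c * h1

/-- Alternating tri-additive functions on `G`. -/
def TV (G : Type) [Group G] : Submodule ℚ (G → G → G → ℚ) where
  carrier := {t | (∀ u v w z, t (u * v) w z = t u w z + t v w z) ∧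
    (∀ u v w, t u v w = t v w u) ∧ (∀ u v w, t u v w = - t w v u)}
  add_mem' := by
    rintro f g ⟨h1, h2, h3⟩ ⟨k1, k2, k3⟩
    refine ⟨fun u v w z => ?_, fun u v w => ?_, fun u v w => ?_⟩
    · simp only [Pi.add_apply, h1 u v, k1 u v]; ring
    · simp only [Pi.add_apply, h2 u v w, k2 u v w]
    · simp only [Pi.add_apply, h3 u v w, k3 u v w]; ring
  zero_mem' := by refine ⟨?_, ?_, ?_⟩ <;> intros <;> simp
  smul_mem' := by
    rintro c g ⟨k1, k2, k3⟩
    refine ⟨fun u v w z => ?_, fun u v w => ?_, fun u v w => ?_⟩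
    · simp only [Pi.smul_apply, k1 u v, smul_eq_mul]; ring
    · simp only [Pi.smul_apply, k2 u v w]
    · simp only [Pi.smul_apply, k3 u v w, smul_eq_mul]; ring

def QV.comap (φ : G →* H) : QV H →ₗ[ℚ] QV G where
  toFun f := ⟨fun u => f.1 (φ u), fun u v => by simpa using f.2 (φ u) (φ v)⟩
  map_add' _ _ := rfl
  map_smul' _ _ := rfl

def TV.comap (φ : G →* H) : TV H →ₗ[ℚ] TV G where
  toFun f := ⟨fun u v w => f.1 (φ u) (φ v) (φ w), 
    ⟨fun u v w z => by simpa using f.2.1 _ _ _ _, fun u v w => f.2.2.1 _ _ _,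
     fun u v w => f.2.2.2 _ _ _⟩⟩
  map_add' _ _ := rfl
  map_smul' _ _ := rfl

def actV (G : Type) [Group G] : MulAut G →* LinearMap.GeneralLinearGroup ℚ (QV G) :=
  MonoidHom.toHomUnits
    { toFun := fun e => QV.comap (e⁻¹ : MulAut G).toMonoidHom
      map_one' := rfl
      map_mul' := fun e₁ e₂ => by rw [mul_inv_rev]; rfl }

def actT (G : Type) [Group G] : MulAut G →* LinearMap.GeneralLinearGroup ℚ (TV G) :=
  MonoidHom.toHomUnits
    { toFun := fun e => TV.comap (e⁻¹ : MulAut G).toMonoidHom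
      map_one' := rfl
      map_mul' := fun e₁ e₂ => by rw [mul_inv_rev]; rfl }

theorem actV_apply (e : MulAut G) (f : QV G) (u : G) :
    ((actV G e : QV G →ₗ[ℚ] QV G) f).1 u = f.1 ((e⁻¹ : MulAut G) u) := rfl

theorem actT_apply (e : MulAut G) (f : TV G) (u v w : G) :
    ((actT G e : TV G →ₗ[ℚ] TV G) f).1 u v w
      = f.1 ((e⁻¹ : MulAut G) u) ((e⁻¹ : MulAut G) v) ((e⁻¹ : MulAut G) w) := rfl

theorem QV.one (f : QV G) : f.1 1 = 0 := by
  have := f.2 1 1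
  simp at this; linarith

theorem QV.inv (f : QV G) (u : G) : f.1 u⁻¹ = f.1 u := by
  have := f.2 1 u
  simp [QV.one] at this; linarith

theorem QV.comm (f : QV G) (u v : G) : f.1 (u * v) = f.1 (v * u) := by
  have h1 := f.2 u v
  have h2 := f.2 v u
  have h3 := QV.inv f (u * v⁻¹)
  simp only [mul_inv_rev, inv_inv] at h3
  linarith

theorem QV.cyc (f : QV G) (u v w : G) : f.1 (u * v * w) = f.1 (v * w * u) := by
  rw [mul_assoc, QV.comm f]

def Dfun (f : G → ℚ) (u v w : G) : ℚ :=
  f (u * v * w) - f (u * v) - f (u * w) - f (v * w) + f u + f v + f w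

theorem D_cyc (f : QV G) (u v w : G) : Dfun f.1 u v w = Dfun f.1 v w u := by
  unfold Dfun
  rw [QV.cyc f u v w, QV.comm f u v, QV.comm f u w]; ring

theorem D_inv3 (f : QV G) (u v w : G) : Dfun f.1 u v w⁻¹ = - Dfun f.1 u v w := by
  unfold Dfun
  have h1 := f.2 (u * v) w
  have h2 := f.2 u w
  have h3 := f.2 v w
  have h4 := QV.inv f w
  linarith

theorem D_anti (f : QV G) (u v w : G) : Dfun f.1 u v w = - Dfun f.1 w v u := by
  have h : Dfun f.1 u⁻¹ v⁻¹ w⁻¹ = - Dfun f.1 u v w := by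
    rw [D_inv3, D_cyc f, D_inv3, D_cyc f, D_inv3, D_cyc f]; ring
  have h' : Dfun f.1 u⁻¹ v⁻¹ w⁻¹ = Dfun f.1 w v u := by
    unfold Dfun
    have e1 := QV.inv f (w * v * u)
    have e2 := QV.inv f (v * u)
    have e3 := QV.inv f (w * u)
    have e4 := QV.inv f (w * v)
    simp only [mul_inv_rev, ← mul_assoc] at e1 e2 e3 e4
    rw [e1, e2, e3, e4, QV.inv f, QV.inv f, QV.inv f]; ring
  linarith

theorem D_coc (f : QV G) (u v z w : G) :
    Dfun f.1 u v w + Dfun f.1 (u * v) z w = Dfun f.1 v z w + Dfun f.1 u (v * z) w := by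
  unfold Dfun
  simp only [mul_assoc]; ring

theorem D_swap (f : QV G) (u v w : G) : Dfun f.1 u v w = - Dfun f.1 v u w := by
  rw [D_anti, D_cyc, D_cyc, D_cyc, D_cyc]

theorem D_add (f : QV G) (u v z w : G) :
    Dfun f.1 (u * v) z w = Dfun f.1 u z w + Dfun f.1 v z w := by
  have a1 := D_coc f u v z w
  have a2 := D_coc f v z u w
  have a3 := D_coc f z u v w
  rw [D_swap f u (v * z)] at a1
  rw [D_swap f v (z * u)] at a2
  rw [D_swap f z (u * v)] at a3
  have b1 := D_swap f u v w
  have b2 := D_swap f u z w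
  have b3 := D_swap f z v w
  linarith

def DD (G : Type) [Group G] : QV G →ₗ[ℚ] TV G where
  toFun f := ⟨Dfun f.1, D_add f, D_cyc f, D_anti f⟩
  map_add' f g := by
    ext u v w
    simp only [Submodule.coe_add, Pi.add_apply, Dfun]; ring
  map_smul' c g := by
    ext u v w
    simp only [Submodule.coe_smul, Pi.smul_apply, Dfun, RingHom.id_apply, smul_eq_mul]; ring

abbrev WV (G : Type) [Group G] : Submodule ℚ (QV G) := LinearMap.ker (DD G)

theorem mem_WV (f : QV G) : f ∈ WV G ↔ ∀ u v w, Dfun f.1 u v w = 0 := by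
  rw [LinearMap.mem_ker]
  constructor
  · intro h u v w
    exact congrFun (congrFun (congrFun (congrArg Subtype.val h) u) v) w
  · intro h
    ext u v w
    exact h u v w

def Bfun (f : G → ℚ) (u v : G) : ℚ := f (u * v) - f u - f v

theorem B_self (f : QV G) (u : G) : Bfun f.1 u u = 2 * f.1 u := by
  have := f.2 u u
  simp only [mul_inv_cancel, QV.one f] at this
  unfold Bfun; linarith

theorem B_comm (f : QV G) (u v : G) : Bfun f.1 u v = Bfun f.1 v u := by
  unfold Bfun; rw [QV.comm f]; ring

theorem B_add (f : QV G) (hf : f ∈ WV G) (u v w : G) :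
    Bfun f.1 (u * v) w = Bfun f.1 u w + Bfun f.1 v w := by
  have := (mem_WV f).1 hf u v w
  unfold Dfun at this
  unfold Bfun; linarith

/-- An additive function depends only on the class in the abelianization. -/
theorem add_factor (h : G → ℚ) (hh : ∀ u v, h (u * v) = h u + h v) {u v : G}
    (e : Abelianization.of u = Abelianization.of v) : h u = h v := by
  let φ : G →* Multiplicative ℚ := MonoidHom.mk' (fun u => Multiplicative.ofAdd (h u)) (by
    intro a b; rw [hh]; rfl)
  have : Abelianization.lift φ (Abelianization.of u) = Abelianization.lift φ (Abelianization.of v) := by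
    rw [e]
  simpa [φ] using this

theorem of_surj : Function.Surjective (Abelianization.of : G →* Abelianization G) :=
  QuotientGroup.mk_surjective

theorem comap_mem (f : QV (Abelianization G)) : QV.comap Abelianization.of f ∈ WV G := by
  rw [mem_WV]
  intro u v w
  have h1 := D_swap f (Abelianization.of u) (Abelianization.of v) (Abelianization.of w)
  have h2 : Dfun f.1 (Abelianization.of u) (Abelianization.of v) (Abelianization.of w)
    = Dfun f.1 (Abelianization.of v) (Abelianization.of u) (Abelianization.of w) := by
    unfold Dfun
    rw [mul_comm (Abelianization.of u) (Abelianization.of v)]; ring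
  have h3 : Dfun f.1 (Abelianization.of u) (Abelianization.of v) (Abelianization.of w) = 0 := by
    linarith
  simpa [Dfun, QV.comap] using h3

theorem WV_factor (f : QV G) (hf : f ∈ WV G) {u v : G}
    (e : Abelianization.of u = Abelianization.of v) : f.1 u = f.1 v := by
  have a : ∀ w, Bfun f.1 u w = Bfun f.1 v w := fun w =>
    add_factor (fun u => Bfun f.1 u w) (fun a b => B_add f hf a b w) e
  have h1 := B_self f u
  have h2 := B_self f v
  rw [a, B_comm, a] at h1
  linarith

noncomputable def eW (G : Type) [Group G] : QV (Abelianization G) ≃ₗ[ℚ] WV G :=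
  LinearEquiv.ofBijective (LinearMap.codRestrict (WV G) (QV.comap Abelianization.of) comap_mem) (by
    constructor
    · intro f g h
      ext x
      obtain ⟨u, rfl⟩ := of_surj x
      exact congrFun (congrArg (fun z : WV G => z.1.1) h) u
    · rintro ⟨f, hf⟩
      refine ⟨⟨fun x => f.1 (Function.surjInv of_surj x), ?_⟩, ?_⟩
      · intro x y
        have k := f.2 (Function.surjInv of_surj x) (Function.surjInv of_surj y)
        rw [← k]
        congr 1 <;> apply WV_factor f hf <;> simp [Function.surjInv_eq]
      · ext u
        exact WV_factor f hf (by simp [Function.surjInv_eq]))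

theorem eW_apply (q : QV (Abelianization G)) (u : G) :
    ((eW G q).1).1 u = q.1 (Abelianization.of u) := rfl

theorem TV_factor (t : TV G) {u v w u' v' w' : G}
    (eu : Abelianization.of u = Abelianization.of u')
    (ev : Abelianization.of v = Abelianization.of v')
    (ew : Abelianization.of w = Abelianization.of w') : t.1 u v w = t.1 u' v' w' := by
  have key : ∀ {a b : G} (c d : G), Abelianization.of a = Abelianization.of b →
      t.1 a c d = t.1 b c d := fun c d e =>
    add_factor (fun u => t.1 u c d) (fun a b => t.2.1 a b c d) e
  have cyc := t.2.2.1
  rw [key _ _ eu, cyc, key _ _ ev, cyc, key _ _ ew, cyc]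

noncomputable def eT (G : Type) [Group G] : TV (Abelianization G) ≃ₗ[ℚ] TV G :=
  LinearEquiv.ofBijective (TV.comap Abelianization.of) (by
    constructor
    · intro f g h
      ext x y z
      obtain ⟨u, rfl⟩ := of_surj x
      obtain ⟨v, rfl⟩ := of_surj y
      obtain ⟨w, rfl⟩ := of_surj z
      exact congrFun (congrFun (congrFun (congrArg (fun z : TV G => z.1) h) u) v) w
    · intro t
      refine ⟨⟨fun x y z => t.1 (Function.surjInv of_surj x) (Function.surjInv of_surj y)
        (Function.surjInv of_surj z), ?_, ?_, ?_⟩, ?_⟩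
      · intro x y z z'
        rw [← t.2.1]
        apply TV_factor <;> simp [Function.surjInv_eq]
      · intro x y z
        exact t.2.2.1 _ _ _
      · intro x y z
        exact t.2.2.2 _ _ _
      · ext u v w
        apply TV_factor t <;> simp [Function.surjInv_eq])

theorem eT_apply (q : TV (Abelianization G)) (u v w : G) :
    (eT G q).1 u v w
      = q.1 (Abelianization.of u) (Abelianization.of v) (Abelianization.of w) := rfl

/-- The action of `Out(G)` on `QV G`. -/
def rhoV (G : Type) [Group G] : OutGrp G →* LinearMap.GeneralLinearGroup ℚ (QV G) :=
  QuotientGroup.lift (innerAuts G) (actV G) (by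
    intro a ha
    obtain ⟨g, rfl⟩ := MonoidHom.mem_range.mp ha
    ext f u
    rw [actV_apply, ← map_inv, MulAut.conj_apply, QV.comm f]
    simp)

theorem rhoV_mk (e : MulAut G) : rhoV G (QuotientGroup.mk (s := innerAuts G) e) = actV G e := rfl

theorem out_mk (e : MulAut G) :
    outToAbAut G (QuotientGroup.mk (s := innerAuts G) e) = autToAbAut G e := rfl

theorem ab_inv (e : MulAut G) (u : G) :
    ((autToAbAut G e)⁻¹ : MulAut _) (Abelianization.of u)
      = Abelianization.of ((e⁻¹ : MulAut G) u) := by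
  rw [← map_inv]; rfl

theorem out_ind {P : OutGrp G → Prop}
    (h : ∀ e : MulAut G, P (QuotientGroup.mk (s := innerAuts G) e)) (g : OutGrp G) : P g :=
  QuotientGroup.induction_on g h

noncomputable def sigW (G : Type) [Group G] :
    MulAut (Abelianization G) →* LinearMap.GeneralLinearGroup ℚ (WV G) :=
  (LinearMap.GeneralLinearGroup.congrLinearEquiv (eW G)).toMonoidHom.comp (actV (Abelianization G))

theorem sigW_spec (g : OutGrp G) (w : WV G) :
    (((sigW G (outToAbAut G g) : (WV G →ₗ[ℚ] WV G)ˣ) : WV G →ₗ[ℚ] WV G) w : QV G) =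
      ((rhoV G g : (QV G →ₗ[ℚ] QV G)ˣ) : QV G →ₗ[ℚ] QV G) (w : QV G) := by
  induction g using out_ind with
  | h e =>
    obtain ⟨q, rfl⟩ := (eW G).surjective w
    ext u
    rw [rhoV_mk, out_mk, actV_apply, eW_apply]
    have : ((sigW G (autToAbAut G e) : (WV G →ₗ[ℚ] WV G)ˣ) : WV G →ₗ[ℚ] WV G) (eW G q)
      = eW G ((actV (Abelianization G) (autToAbAut G e) :
          QV (Abelianization G) →ₗ[ℚ] QV (Abelianization G)) q) := by
      change eW G ((actV (Abelianization G) (autToAbAut G e) :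
          QV (Abelianization G) →ₗ[ℚ] QV (Abelianization G)) ((eW G).symm (eW G q))) = _
      rw [LinearEquiv.symm_apply_apply]
    rw [this, eW_apply, actV_apply, ab_inv]

noncomputable def eQ (hD : Function.Surjective (DD G)) :
    (QV G ⧸ WV G) ≃ₗ[ℚ] TV (Abelianization G) :=
  ((DD G).quotKerEquivOfSurjective hD).trans (eT G).symm

noncomputable def sigQ (hD : Function.Surjective (DD G)) :
    MulAut (Abelianization G) →* LinearMap.GeneralLinearGroup ℚ (QV G ⧸ WV G) :=
  (LinearMap.GeneralLinearGroup.congrLinearEquiv (eQ hD).symm).toMonoidHom.comp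
    (actT (Abelianization G))

theorem eQ_mk (hD : Function.Surjective (DD G)) (f : QV G) (u v w : G) :
    (eQ hD ((WV G).mkQ f)).1 (Abelianization.of u) (Abelianization.of v) (Abelianization.of w)
      = Dfun f.1 u v w := by
  rw [← eT_apply]
  have : eT G (eQ hD ((WV G).mkQ f)) = DD G f := by
    unfold eQ
    rw [LinearEquiv.trans_apply, LinearEquiv.apply_symm_apply]
    rfl
  rw [this]; rfl

theorem sigQ_spec (hD : Function.Surjective (DD G)) (g : OutGrp G) (f : QV G) :
    ((sigQ hD (outToAbAut G g) : ((QV G ⧸ WV G) →ₗ[ℚ] (QV G ⧸ WV G))ˣ) :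
        (QV G ⧸ WV G) →ₗ[ℚ] (QV G ⧸ WV G)) ((WV G).mkQ f) =
      (WV G).mkQ (((rhoV G g : (QV G →ₗ[ℚ] QV G)ˣ) : QV G →ₗ[ℚ] QV G) f) := by
  induction g using out_ind with
  | h e =>
    apply (eQ hD).injective
    have : eQ hD (((sigQ hD (autToAbAut G e) : ((QV G ⧸ WV G) →ₗ[ℚ] (QV G ⧸ WV G))ˣ) :
        (QV G ⧸ WV G) →ₗ[ℚ] (QV G ⧸ WV G)) ((WV G).mkQ f)) =
        ((actT (Abelianization G) (autToAbAut G e) :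
          TV (Abelianization G) →ₗ[ℚ] TV (Abelianization G)) (eQ hD ((WV G).mkQ f))) := by
      change eQ hD ((eQ hD).symm _) = _
      rw [LinearEquiv.apply_symm_apply]; rfl
    rw [rhoV_mk, out_mk, this]
    ext x y z
    obtain ⟨u, rfl⟩ := of_surj x
    obtain ⟨v, rfl⟩ := of_surj y
    obtain ⟨w, rfl⟩ := of_surj z
    rw [actT_apply, ab_inv, ab_inv, ab_inv, eQ_mk, eQ_mk]
    simp [Dfun, actV_apply]

end QFE

section Heis

/-- A two-step nilpotent group on `ℚ³ × ℚ³` (cross product commutator). -/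
@[ext] structure Hs where
  a : ℚ
  b : ℚ
  c : ℚ
  p : ℚ
  q : ℚ
  r : ℚ

instance : Mul Hs := ⟨fun x y => ⟨x.a + y.a, x.b + y.b, x.c + y.c,
  x.p + y.p + (x.b * y.c - x.c * y.b) / 2,
  x.q + y.q + (x.c * y.a - x.a * y.c) / 2,
  x.r + y.r + (x.a * y.b - x.b * y.a) / 2⟩⟩
instance : One Hs := ⟨⟨0, 0, 0, 0, 0, 0⟩⟩
instance : Inv Hs := ⟨fun x => ⟨-x.a, -x.b, -x.c, -x.p, -x.q, -x.r⟩⟩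

theorem Hs.mul_def (x y : Hs) : x * y = ⟨x.a + y.a, x.b + y.b, x.c + y.c,
  x.p + y.p + (x.b * y.c - x.c * y.b) / 2,
  x.q + y.q + (x.c * y.a - x.a * y.c) / 2,
  x.r + y.r + (x.a * y.b - x.b * y.a) / 2⟩ := rfl
theorem Hs.one_def : (1 : Hs) = ⟨0, 0, 0, 0, 0, 0⟩ := rfl
theorem Hs.inv_def (x : Hs) : x⁻¹ = ⟨-x.a, -x.b, -x.c, -x.p, -x.q, -x.r⟩ := rfl

instance : Group Hs := Group.ofLeftAxioms
  (by intro x y z; ext <;> simp only [Hs.mul_def] <;> ring)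
  (by intro x; ext <;> simp only [Hs.mul_def, Hs.one_def] <;> ring)
  (by intro x; ext <;> simp only [Hs.mul_def, Hs.one_def, Hs.inv_def] <;> ring)

def Hs.f : QV Hs := ⟨fun x => 2 * (x.a * x.p + x.b * x.q + x.c * x.r), by
  intro x y
  simp only [Hs.mul_def, Hs.inv_def]; ring⟩

theorem Hs.D (x y z : Hs) : Dfun Hs.f.1 x y z =
    x.a * y.b * z.c + x.b * y.c * z.a + x.c * y.a * z.b
     - x.a * y.c * z.b - x.b * y.a * z.c - x.c * y.b * z.a := by
  simp only [Dfun, Hs.f, Hs.mul_def]; ring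

end Heis

section FreePart

variable {n : ℕ}

local notation "FF" => FreeGroup (Fin n)

def ind (i j : Fin n) : ℚ := if i = j then 1 else 0

theorem ind_det (i j k x y z : Fin n) (h1 : i < j) (h2 : j < k) (g1 : x < y) (g2 : y < z) :
    ind x i * ind y j * ind z k + ind x j * ind y k * ind z i + ind x k * ind y i * ind z j
     - ind x i * ind y k * ind z j - ind x j * ind y i * ind z k - ind x k * ind y j * ind z i
     = if i = x ∧ j = y ∧ k = z then 1 else 0 := by
  have e1 : ind x j * ind y k * ind z i = 0 := by
    unfold ind; split_ifs <;> simp; omega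
  have e2 : ind x k * ind y i * ind z j = 0 := by
    unfold ind; split_ifs <;> simp; omega
  have e3 : ind x i * ind y k * ind z j = 0 := by
    unfold ind; split_ifs <;> simp; omega
  have e4 : ind x j * ind y i * ind z k = 0 := by
    unfold ind; split_ifs <;> simp; omega
  have e5 : ind x k * ind y j * ind z i = 0 := by
    unfold ind; split_ifs <;> simp; omega
  rw [e1, e2, e3, e4, e5]
  unfold ind
  by_cases c1 : i = x <;> by_cases c2 : j = y <;> by_cases c3 : k = z <;>
    simp [c1, c2, c3, eq_comm (a := x), eq_comm (a := y), eq_comm (a := z)]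

def hHs (i j k : Fin n) : FF →* Hs :=
  FreeGroup.lift (fun x => ⟨ind x i, ind x j, ind x k, 0, 0, 0⟩)

def fH (i j k : Fin n) : QV FF := QV.comap (hHs i j k) Hs.f

theorem fH_D (i j k x y z : Fin n) (h1 : i < j) (h2 : j < k) (g1 : x < y) (g2 : y < z) :
    Dfun (fH i j k).1 (FreeGroup.of x) (FreeGroup.of y) (FreeGroup.of z) =
      if i = x ∧ j = y ∧ k = z then 1 else 0 := by
  rw [← ind_det i j k x y z h1 h2 g1 g2]
  have : Dfun (fH i j k).1 (FreeGroup.of x) (FreeGroup.of y) (FreeGroup.of z) =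
    Dfun Hs.f.1 (hHs i j k (FreeGroup.of x)) (hHs i j k (FreeGroup.of y))
      (hHs i j k (FreeGroup.of z)) := by
    simp only [Dfun, fH, QV.comap, LinearMap.coe_mk, AddHom.coe_mk, map_mul]
  rw [this, Hs.D]
  simp only [hHs, FreeGroup.lift_apply_of]

def evT (n : ℕ) : TV (FreeGroup (Fin n)) →ₗ[ℚ] ((Fin 3 ↪o Fin n) → ℚ) where
  toFun t s := t.1 (FreeGroup.of (s 0)) (FreeGroup.of (s 1)) (FreeGroup.of (s 2))
  map_add' _ _ := rfl
  map_smul' _ _ := rfl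

theorem add_zero_of_gen (h : FF → ℚ) (hh : ∀ u v, h (u * v) = h u + h v)
    (h0 : ∀ i, h (FreeGroup.of i) = 0) (u : FF) : h u = 0 := by
  let φ : FF →* Multiplicative ℚ := MonoidHom.mk' (fun u => Multiplicative.ofAdd (h u)) (by
    intro a b; rw [hh]; rfl)
  have : φ = 1 := by
    ext i
    simp [φ, h0]
  have h2 : φ u = 1 := by rw [this]; rfl
  exact h2

theorem evT_inj : Function.Injective (evT n) := by
  rw [← LinearMap.ker_eq_bot, LinearMap.ker_eq_bot']
  intro t ht
  obtain ⟨t, hadd, hcyc, hanti⟩ := t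
  have h0 : ∀ i j k : Fin n, i < j → j < k →
      t (FreeGroup.of i) (FreeGroup.of j) (FreeGroup.of k) = 0 := by
    intro i j k h1 h2
    have hs : StrictMono ![i, j, k] := by
      rw [Fin.strictMono_iff_lt_succ]
      intro a
      fin_cases a
      · exact h1
      · exact h2
    exact congrFun ht (OrderEmbedding.ofStrictMono ![i, j, k] hs)
  have hswap : ∀ u v w, t u v w = - t v u w := by
    intro u v w
    rw [hanti, hcyc w v u]
  have hdiag : ∀ u w, t u u w = 0 := by
    intro u w
    have := hswap u u w
    linarith
  have h1 : ∀ i j k : Fin n, t (FreeGroup.of i) (FreeGroup.of j) (FreeGroup.of k) = 0 := by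
    have h2 : ∀ i j k : Fin n, i < j →
        t (FreeGroup.of i) (FreeGroup.of j) (FreeGroup.of k) = 0 := by
      intro i j k hij
      rcases lt_trichotomy j k with h | h | h
      · exact h0 i j k hij h
      · subst h
        rw [hcyc, hdiag]
      · rcases lt_trichotomy i k with h' | h' | h'
        · rw [hcyc, hswap, hcyc, hcyc, h0 i k j h' h]; simp
        · subst h'
          rw [hcyc, hcyc, hdiag]
        · rw [hcyc, hcyc, h0 k i j h' hij]
    intro i j k
    rcases lt_trichotomy i j with h | h | h
    · exact h2 i j k h
    · subst h; exact hdiag _ _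
    · rw [hswap, h2 j i k h]; simp
  ext u v w
  change t u v w = 0
  have e1 : ∀ i j (w : FF), t w (FreeGroup.of i) (FreeGroup.of j) = 0 := fun i j =>
    add_zero_of_gen _ (fun a b => hadd a b _ _) (fun k => h1 _ _ _)
  have e2 : ∀ i (v w : FF), t v w (FreeGroup.of i) = 0 := fun i v w =>
    add_zero_of_gen (fun v => t v w (FreeGroup.of i)) (fun a b => hadd a b _ _)
      (fun k => by rw [hcyc, e1]) v
  exact add_zero_of_gen (fun u => t u v w) (fun a b => hadd a b _ _)
      (fun k => by rw [hcyc, e2]) u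

noncomputable instance : Fintype (Fin 3 ↪o Fin n) :=
  Fintype.ofEquiv _ (Set.powersetCard.ofFinEmbEquiv (n := 3) (I := Fin n)).symm

theorem card_I3 : Fintype.card (Fin 3 ↪o Fin n) = n.choose 3 := by
  rw [← Nat.card_eq_fintype_card, Nat.card_congr Set.powersetCard.ofFinEmbEquiv,
    Set.powersetCard.card, Nat.card_eq_fintype_card, Fintype.card_fin]

theorem evD_surj : Function.Surjective ((evT n).comp (DD FF)) := by
  classical
  intro c
  refine ⟨∑ s : Fin 3 ↪o Fin n, c s • fH (s 0) (s 1) (s 2), ?_⟩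
  rw [map_sum]
  ext s'
  rw [Finset.sum_apply]
  have : ∀ s : Fin 3 ↪o Fin n,
      ((evT n).comp (DD FF)) (c s • fH (s 0) (s 1) (s 2)) s' = if s = s' then c s else 0 := by
    intro s
    rw [map_smul, Pi.smul_apply]
    change c s • Dfun (fH (s 0) (s 1) (s 2)).1 (FreeGroup.of (s' 0)) (FreeGroup.of (s' 1))
      (FreeGroup.of (s' 2)) = _
    rw [fH_D _ _ _ _ _ _ (s.strictMono (by decide)) (s.strictMono (by decide))
      (s'.strictMono (by decide)) (s'.strictMono (by decide))]
    have : (s 0 = s' 0 ∧ s 1 = s' 1 ∧ s 2 = s' 2) ↔ s = s' := by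
      constructor
      · rintro ⟨h0, h1, h2⟩
        ext a
        fin_cases a
        · exact congrArg Fin.val h0
        · exact congrArg Fin.val h1
        · exact congrArg Fin.val h2
      · rintro rfl; simp
    simp [this]
  simp [this]

theorem DD_surj : Function.Surjective (DD FF) := by
  intro t
  obtain ⟨f, hf⟩ := evD_surj (evT n t)
  exact ⟨f, evT_inj hf⟩

noncomputable def eTI : TV FF ≃ₗ[ℚ] ((Fin 3 ↪o Fin n) → ℚ) :=
  LinearEquiv.ofBijective (evT n) ⟨evT_inj, fun c => by
    obtain ⟨f, hf⟩ := evD_surj c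
    exact ⟨DD _ f, hf⟩⟩

noncomputable def eQI : (QV FF ⧸ WV FF) ≃ₗ[ℚ] ((Fin 3 ↪o Fin n) → ℚ) :=
  ((DD FF).quotKerEquivOfSurjective DD_surj).trans eTI

theorem finrank_Q : Module.finrank ℚ (QV FF ⧸ WV FF) = n.choose 3 := by
  rw [LinearEquiv.finrank_eq eQI, Module.finrank_fintype_fun_eq_card, card_I3]

def evW (n : ℕ) : WV (FreeGroup (Fin n)) →ₗ[ℚ] (Sym2 (Fin n) → ℚ) where
  toFun f := Sym2.lift ⟨fun i j => Bfun f.1.1 (FreeGroup.of i) (FreeGroup.of j),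
    fun i j => B_comm f.1 _ _⟩
  map_add' f g := by
    ext s
    induction s using Sym2.ind with
    | _ i j => 
      simp only [Sym2.lift_mk, Pi.add_apply, Bfun, Submodule.coe_add]; ring
  map_smul' c f := by
    ext s
    induction s using Sym2.ind with
    | _ i j => 
      simp only [Sym2.lift_mk, Pi.smul_apply, Bfun, Submodule.coe_smul, smul_eq_mul,
        RingHom.id_apply]; ring

theorem evW_inj : Function.Injective (evW n) := by
  refine (injective_iff_map_eq_zero _).2 ?_
  rintro ⟨f, hf⟩ h
  have h0 : ∀ i j : Fin n, Bfun f.1 (FreeGroup.of i) (FreeGroup.of j) = 0 := fun i j =>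
    congrFun h s(i, j)
  have h1 : ∀ (j : Fin n) (u : FF), Bfun f.1 u (FreeGroup.of j) = 0 := fun j =>
    add_zero_of_gen _ (fun a b => B_add f hf a b _) (fun i => h0 i j)
  have h2 : ∀ (v u : FF), Bfun f.1 u v = 0 := fun v =>
    add_zero_of_gen _ (fun a b => B_add f hf a b _) (fun i => by rw [B_comm, h1])
  ext u
  have h3 := B_self f u
  rw [h2] at h3
  change f.1 u = 0
  linarith

def co (i : Fin n) (u : FF) : ℚ :=
  Multiplicative.toAdd (FreeGroup.lift (fun k => Multiplicative.ofAdd (ind k i)) u)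

theorem co_mul (i : Fin n) (u v : FF) : co i (u * v) = co i u + co i v := by
  simp [co]

theorem co_inv (i : Fin n) (u : FF) : co i u⁻¹ = - co i u := by
  simp [co]

theorem co_of (i k : Fin n) : co i (FreeGroup.of k) = ind k i := by
  simp [co]

def qf (i j : Fin n) : QV FF := ⟨fun u => co i u * co j u, by
  intro u v
  simp only [co_mul, co_inv]; ring⟩

theorem qf_mem (i j : Fin n) : qf i j ∈ WV FF := by
  rw [mem_WV]
  intro u v w
  simp only [Dfun, qf, co_mul]; ring

theorem evW_qf (i j k l : Fin n) : evW n ⟨qf i j, qf_mem i j⟩ s(k, l) =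
    ind k i * ind l j + ind l i * ind k j := by
  change Bfun (qf i j).1 (FreeGroup.of k) (FreeGroup.of l) = _
  simp only [Bfun, qf, co_mul, co_of]; ring

theorem evW_surj : Function.Surjective (evW n) := by
  intro c
  refine ⟨∑ i, ∑ j, (c s(i, j) / 2) • ⟨qf i j, qf_mem i j⟩, ?_⟩
  ext s
  induction s using Sym2.ind with
  | _ k l =>
    simp only [map_sum, map_smul, Finset.sum_apply, Pi.smul_apply, evW_qf, smul_eq_mul, mul_add,
      Finset.sum_add_distrib]
    simp only [ind, mul_ite, mul_one, mul_zero, Finset.sum_ite_eq, Finset.mem_univ, if_true]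
    simp [Sym2.eq_swap (a := l) (b := k)]

noncomputable def eWI : WV FF ≃ₗ[ℚ] (Sym2 (Fin n) → ℚ) :=
  LinearEquiv.ofBijective (evW n) ⟨evW_inj, evW_surj⟩

theorem finrank_W : Module.finrank ℚ (WV FF) = n * (n + 1) / 2 := by
  rw [LinearEquiv.finrank_eq eWI, Module.finrank_fintype_fun_eq_card, Sym2.card, Fintype.card_fin,
    Nat.choose_two_right, Nat.add_sub_cancel, mul_comm]

theorem fin_V : FiniteDimensional ℚ (QV FF) := by
  have h1 : Module.Finite ℚ (WV FF) := Module.Finite.equiv eWI.symm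
  have h2 : Module.Finite ℚ (QV FF ⧸ WV FF) := Module.Finite.equiv eQI.symm
  exact Module.Finite.of_submodule_quotient (WV FF)

theorem num_id (n : ℕ) : n.choose 3 + n * (n + 1) / 2 = n * (n ^ 2 + 5) / 6 := by
  have h2 : n * (n + 1) / 2 = (n + 1).choose 2 := by
    rw [Nat.choose_two_right, Nat.add_sub_cancel, mul_comm]
  rw [h2]
  symm
  apply Nat.div_eq_of_eq_mul_left (by norm_num)
  induction n with
  | zero => rfl
  | succ m ih =>
    have e1 : (m + 1).choose 3 = m.choose 2 + m.choose 3 := Nat.choose_succ_succ m 2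
    have e2 : (m + 1 + 1).choose 2 = (m + 1) + (m + 1).choose 2 := by
      rw [Nat.choose_succ_succ (m + 1) 1, Nat.choose_one_right]
    have e3 : m.choose 2 * 2 = m * (m - 1) := by
      rw [Nat.choose_two_right, Nat.div_mul_cancel (Nat.even_mul_pred_self m).two_dvd]
    have ih' := ih (by rw [Nat.choose_two_right, Nat.add_sub_cancel, mul_comm])
    rw [e1, e2]
    cases m with
    | zero => rfl
    | succ k =>
      simp only [Nat.add_sub_cancel] at e3
      nlinarith

theorem finrank_V : Module.finrank ℚ (QV FF) = n * (n ^ 2 + 5) / 6 := by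
  have := fin_V (n := n)
  rw [← Submodule.finrank_quotient_add_finrank (WV FF), finrank_Q, finrank_W, num_id]

open scoped commutatorElement

/-- `x_i ↦ x_i c`, other generators fixed. -/
def tv (i : Fin n) (c : FF) : FF →* FF :=
  FreeGroup.lift (fun k => if k = i then FreeGroup.of i * c else FreeGroup.of k)

theorem tv_tv (i : Fin n) (c d : FF) (h : tv i c d = d) (hd : c * d = 1) :
    (tv i c).comp (tv i d) = MonoidHom.id _ := by
  ext k
  by_cases hk : k = i
  · subst hk
    simp only [tv, MonoidHom.comp_apply, FreeGroup.lift_apply_of, if_true, map_mul] at h ⊢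
    rw [h, mul_assoc, hd]; simp
  · simp [tv, hk]

theorem tv_comm (i j k : Fin n) (hj : j ≠ i) (hk : k ≠ i) (c : FF) :
    tv i c ⁅FreeGroup.of j, FreeGroup.of k⁆ = ⁅FreeGroup.of j, FreeGroup.of k⁆ := by
  rw [map_commutatorElement]
  simp [tv, hj, hk]

def tvAut (i j k : Fin n) (hj : j ≠ i) (hk : k ≠ i) : MulAut FF :=
  MonoidHom.toMulEquiv (tv i ⁅FreeGroup.of j, FreeGroup.of k⁆)
    (tv i ⁅FreeGroup.of j, FreeGroup.of k⁆⁻¹)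
    (tv_tv _ _ _ (tv_comm i j k hj hk _) (inv_mul_cancel _))
    (tv_tv _ _ _ (by rw [map_inv, tv_comm i j k hj hk]) (mul_inv_cancel _))

theorem tvAut_ab (i j k : Fin n) (hj : j ≠ i) (hk : k ≠ i) :
    autToAbAut FF (tvAut i j k hj hk) = 1 := by
  apply MulEquiv.toMonoidHom_injective
  apply Abelianization.hom_ext
  ext x
  change Abelianization.of (tv i ⁅FreeGroup.of j, FreeGroup.of k⁆ (FreeGroup.of x)) =
    Abelianization.of (FreeGroup.of x)
  simp only [tv, FreeGroup.lift_apply_of]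
  split_ifs with h
  · subst h
    rw [map_mul, map_commutatorElement, commutatorElement_eq_one_iff_mul_comm.2 (mul_comm _ _),
      mul_one]
  · rfl

theorem not_factor (i j k : Fin n) (hij : i < j) (hjk : j < k) :
    ¬ ∃ σ : MulAut (Abelianization FF) →* LinearMap.GeneralLinearGroup ℚ (QV FF),
            rhoV FF = σ.comp (outToAbAut FF) := by
  rintro ⟨σ, hσ⟩
  have hj : j ≠ i := by omega
  have hk : k ≠ i := by omega
  have h1 : actV FF (tvAut i j k hj hk) = 1 := by
    rw [← rhoV_mk, hσ]
    change σ (autToAbAut FF (tvAut i j k hj hk)) = 1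
    rw [tvAut_ab, map_one]
  have h2 : actV FF ((tvAut i j k hj hk)⁻¹) = 1 := by
    rw [map_inv, h1, inv_one]
  have h3 := actV_apply ((tvAut i j k hj hk)⁻¹) (fH i j k) (FreeGroup.of i)
  rw [h2, inv_inv] at h3
  have h4 : tvAut i j k hj hk (FreeGroup.of i) =
      FreeGroup.of i * ⁅FreeGroup.of j, FreeGroup.of k⁆ := by
    change tv i ⁅FreeGroup.of j, FreeGroup.of k⁆ (FreeGroup.of i) = _
    simp [tv]
  rw [h4] at h3
  change Hs.f.1 (hHs i j k (FreeGroup.of i)) = Hs.f.1 (hHs i j k _) at h3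
  rw [map_mul, map_commutatorElement] at h3
  have a1 : i ≠ j := by omega
  have a2 : i ≠ k := by omega
  have a3 : j ≠ k := by omega
  simp [hHs, Hs.f, commutatorElement_def, Hs.mul_def, Hs.inv_def, ind, hj, hk, a1, a2, a3,
    a3.symm] at h3

end FreePart

/-- (Theorem 1 refined by the Hodge filtration.) For every `n ≥ 3` there
exist a `ℚ`-representation `ρ` of `Out(F_n)` of dimension `n(n²+5)/6` that does not factor
through `GL(n,ℤ) ≅ Aut(F_n^{ab})`, and a `ρ`-invariant subspace `W` with
`dim W = n(n+1)/2` and `dim V/W = C(n,3)`, such that the induced representations on `W`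
and on `V/W` both factor through the canonical map `π : Out(F_n) → Aut(F_n^{ab})`. -/
theorem stmt_1 : ∀ n : ℕ, 3 ≤ n →
    ∃ (V : Type) (_ : AddCommGroup V) (_ : Module ℚ V),
      FiniteDimensional ℚ V ∧
      Module.finrank ℚ V = n * (n ^ 2 + 5) / 6 ∧
      ∃ ρ : OutGrp (FreeGroup (Fin n)) →* LinearMap.GeneralLinearGroup ℚ V,
        -- ρ does not factor through GL(n,ℤ)
        (¬ ∃ σ : MulAut (Abelianization (FreeGroup (Fin n))) →*
              LinearMap.GeneralLinearGroup ℚ V,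
            ρ = σ.comp (outToAbAut (FreeGroup (Fin n)))) ∧
        ∃ W : Submodule ℚ V,
          -- W is ρ-invariant
          (∀ (g : OutGrp (FreeGroup (Fin n))) (w : V), w ∈ W →
            ((ρ g : (V →ₗ[ℚ] V)ˣ) : V →ₗ[ℚ] V) w ∈ W) ∧
          Module.finrank ℚ W = n * (n + 1) / 2 ∧
          Module.finrank ℚ (V ⧸ W) = Nat.choose n 3 ∧
          -- the induced representation on W, and the fact that it factors through π
          (∃ ρW : OutGrp (FreeGroup (Fin n)) →* LinearMap.GeneralLinearGroup ℚ W,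
            (∀ (g : OutGrp (FreeGroup (Fin n))) (w : W),
              (((ρW g : (W →ₗ[ℚ] W)ˣ) : W →ₗ[ℚ] W) w : V) =
                ((ρ g : (V →ₗ[ℚ] V)ˣ) : V →ₗ[ℚ] V) (w : V)) ∧
            ∃ σW : MulAut (Abelianization (FreeGroup (Fin n))) →*
                LinearMap.GeneralLinearGroup ℚ W,
              ρW = σW.comp (outToAbAut (FreeGroup (Fin n)))) ∧
          -- the induced representation on V/W, and the fact that it factors through π
          (∃ ρQ : OutGrp (FreeGroup (Fin n)) →* LinearMap.GeneralLinearGroup ℚ (V ⧸ W),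
            (∀ (g : OutGrp (FreeGroup (Fin n))) (v : V),
              ((ρQ g : ((V ⧸ W) →ₗ[ℚ] (V ⧸ W))ˣ) : (V ⧸ W) →ₗ[ℚ] (V ⧸ W)) (W.mkQ v) =
                W.mkQ (((ρ g : (V →ₗ[ℚ] V)ˣ) : V →ₗ[ℚ] V) v)) ∧
            ∃ σQ : MulAut (Abelianization (FreeGroup (Fin n))) →*
                LinearMap.GeneralLinearGroup ℚ (V ⧸ W),
              ρQ = σQ.comp (outToAbAut (FreeGroup (Fin n)))) := by
  intro n hn
  refine ⟨QV (FreeGroup (Fin n)), inferInstance, inferInstance, fin_V, finrank_V,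
    rhoV (FreeGroup (Fin n)), ?_, WV (FreeGroup (Fin n)), ?_, finrank_W, finrank_Q, ?_, ?_⟩
  · exact not_factor ⟨0, by omega⟩ ⟨1, by omega⟩ ⟨2, by omega⟩ (by simp) (by simp)
  · intro g w hw
    rw [← sigW_spec g ⟨w, hw⟩]
    exact Subtype.property _
  · exact ⟨(sigW _).comp (outToAbAut _), fun g w => sigW_spec g w, sigW _, rfl⟩
  · exact ⟨(sigQ DD_surj).comp (outToAbAut _), fun g v => sigQ_spec DD_surj g v, sigQ DD_surj, rfl⟩
end

section
/- (Proposition 2.2 and Theorem 1.2, degree-zero case) Let K be a field and H a cocommutative Hopf algebra over K with primitive filtration F_m, let T be the right action of End(F_n) on H^{⊗n} given by T(Ψ) := (w(Ψ(x₁))⊗⋯⊗w(Ψ(xₙ)))∘Δ^{[n]}_{H^{⊗n}}, and set F_m(H^{⊗n}) := Σ_{m₁+⋯+mₙ=m} F_{m₁}H⊗⋯⊗F_{mₙ}H. Then: (i) T(Ψ)(F_m(H^{⊗n})) ⊆ F_m(H^{⊗n}) for every Ψ ∈ End(F_n) and every m ≥ 0; (ii) if moreover K has characteristic 0, H is connected,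 and Ψ₁, Ψ₂ ∈ End(F_n) induce the same endomorphism of the abelianization F_n^{ab} ≅ ℤ^n, then (T(Ψ₁) − T(Ψ₂))(F_m(H^{⊗n})) ⊆ F_{m−1}(H^{⊗n}) for all m ≥ 1; i.e., the induced action on the associated graded factors through End(ℤ^n). -/
open scoped TensorProduct

noncomputable section

/-- A bundled `K`-coalgebra (used to form iterated tensor powers recursively). -/
structure CoalgBundle (K : Type) [CommRing K] : Type 1 where
  carrier : Type
  [acg : AddCommGroup carrier]
  [mod : Module K carrier]
  [coalg : Coalgebra K carrier]

attribute [instance] CoalgBundle.acg CoalgBundle.mod CoalgBundle.coalg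

variable (K H : Type) [Field K] [Ring H] [HopfAlgebra K H]

/-- `HTPow n` is the coalgebra `H^{⊗n}` (with `H^{⊗0} = K`), with the tensor-product
coalgebra structure. -/
def HTPow : ℕ → CoalgBundle K
  | 0 => { carrier := K }
  | n + 1 => { carrier := H ⊗[K] (HTPow n).carrier }

/-- Iterated tensor powers of a module `C`: `cpow C n = C^{⊗n}` (with `C^{⊗0} = K`). -/
def cpow (C : Type) [AddCommGroup C] [Module K C] : ℕ → ModuleCat K
  | 0 => ModuleCat.of K K
  | n + 1 => ModuleCat.of K (C ⊗[K] (cpow C n))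

/-- The iterated comultiplication `Δ^{[n]} : C → C^{⊗n}` of a coalgebra `C`. -/
def deltaIter (C : Type) [AddCommGroup C] [Module K C] [Coalgebra K C] :
    (n : ℕ) → (C →ₗ[K] cpow K C n)
  | 0 => Coalgebra.counit
  | n + 1 => (TensorProduct.map LinearMap.id (deltaIter C n)) ∘ₗ (Coalgebra.comul (R := K))

/-- The tensor product `f₁ ⊗ ⋯ ⊗ fₙ : C^{⊗n} → H^{⊗n}` of linear maps `fᵢ : C → H`. -/
def multiMap (C : Type) [AddCommGroup C] [Module K C] :
    (n : ℕ) → (Fin n → (C →ₗ[K] H)) → (cpow K C n →ₗ[K] (HTPow K H n).carrier)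
  | 0, _ => LinearMap.id
  | n + 1, f => TensorProduct.map (f 0) (multiMap C n (fun j => f j.succ))

/-- The coalgebra morphism `π_i : H^{⊗n} → H`. -/
def proj : (n : ℕ) → Fin n → ((HTPow K H n).carrier →ₗ[K] H)
  | 0, i => i.elim0
  | n + 1, i => Fin.cases
      ((TensorProduct.rid K H).toLinearMap ∘ₗ
        TensorProduct.map LinearMap.id (Coalgebra.counit (R := K) (A := (HTPow K H n).carrier)))
      (fun j => (proj n j) ∘ₗ ((TensorProduct.lid K (HTPow K H n).carrier).toLinearMap ∘ₗ
        TensorProduct.map (Coalgebra.counit (R := K) (A := H)) LinearMap.id))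
      i

/-- The convolution product `f ∗ g = μ ∘ (f ⊗ g) ∘ Δ` of linear maps `C → H`. -/
def conv (C : Type) [AddCommGroup C] [Module K C] [Coalgebra K C]
    (f g : C →ₗ[K] H) : C →ₗ[K] H :=
  (LinearMap.mul' K H) ∘ₗ (TensorProduct.map f g) ∘ₗ (Coalgebra.comul (R := K))

/-- The convolution unit `1·ε : C → H`. -/
def convUnit (C : Type) [AddCommGroup C] [Module K C] [Coalgebra K C] : C →ₗ[K] H :=
  (Algebra.linearMap K H) ∘ₗ (Coalgebra.counit (R := K) (A := C))

/-- `f : C → D` is a morphism of `K`-coalgebras. -/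
def IsCoalgMor {C D : Type} [AddCommGroup C] [Module K C] [Coalgebra K C]
    [AddCommGroup D] [Module K D] [Coalgebra K D] (f : C →ₗ[K] D) : Prop :=
  (Coalgebra.counit (R := K)) ∘ₗ f = Coalgebra.counit ∧
  (Coalgebra.comul (R := K)) ∘ₗ f = (TensorProduct.map f f) ∘ₗ (Coalgebra.comul (R := K))

/-- `H` is cocommutative if `τ ∘ Δ = Δ`. -/
def IsCocomm : Prop :=
  (TensorProduct.comm K H H).toLinearMap ∘ₗ (Coalgebra.comul (R := K) (A := H)) =
    Coalgebra.comul (R := K) (A := H)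

/-- Iterated tensor powers for the reduced comultiplication: `TPow m = H^{⊗(m+1)}`. -/
def TPow : ℕ → ModuleCat K
  | 0 => ModuleCat.of K H
  | m + 1 => ModuleCat.of K (H ⊗[K] (TPow m))

/-- The projection `P = id − 1·ε` of `H`; it restricts to the identity on `H⁺ = ker ε`. -/
def projAug : H →ₗ[K] H :=
  LinearMap.id - (Algebra.linearMap K H) ∘ₗ (Coalgebra.counit (R := K) (A := H))

/-- `redDelta m` restricted to `H⁺` is the iterated reduced comultiplication
`Δ̄^{[m+1]} : H⁺ → (H⁺)^{⊗(m+1)}` (viewed inside `H^{⊗(m+1)}`). -/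
def redDelta : (m : ℕ) → (H →ₗ[K] TPow K H m)
  | 0 => projAug K H
  | m + 1 => (TensorProduct.map (projAug K H) (redDelta m)) ∘ₗ (Coalgebra.comul (R := K) (A := H))

/-- The primitive filtration: `F_0 = K·1` and
`F_m = K·1 + {x ∈ H⁺ : Δ̄^{[m+1]}(x) = 0}` for `m ≥ 1`. -/
def primFil (m : ℕ) : Submodule K H :=
  Submodule.span K {(1 : H)} ⊔
    (LinearMap.ker (Coalgebra.counit (R := K) (A := H)) ⊓ LinearMap.ker (redDelta K H m))

/-- The induced filtration `F_m(H^{⊗n}) = Σ_{m₁+⋯+mₙ=m} F_{m₁}H ⊗ ⋯ ⊗ F_{mₙ}H`. -/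
def filHTPow : (n : ℕ) → ℕ → Submodule K (HTPow K H n).carrier
  | 0, _ => ⊤
  | n + 1, m => ⨆ i ∈ Finset.range (m + 1),
      LinearMap.range (TensorProduct.map (primFil K H i).subtype (filHTPow n (m - i)).subtype)

section helpers
open TensorProduct

variable {K H}
set_option linter.unusedSectionVars false

def fprod {A B : Type} [AddCommGroup A] [Module K A] [AddCommGroup B] [Module K B]
    (F : ℕ → Submodule K A) (G : ℕ → Submodule K B) (m : ℕ) : Submodule K (A ⊗[K] B) :=
  ⨆ i ∈ Finset.range (m + 1),
      LinearMap.range (TensorProduct.map (F i).subtype (G (m - i)).subtype)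

section gen
variable {A B A' B' V W C : Type} [AddCommGroup A] [Module K A] [AddCommGroup B] [Module K B]
  [AddCommGroup A'] [Module K A'] [AddCommGroup B'] [Module K B']
  [AddCommGroup V] [Module K V] [AddCommGroup W] [Module K W]
  [AddCommGroup C] [Module K C] [Coalgebra K C]

lemma fprod_tmul_mem {F : ℕ → Submodule K A} {G : ℕ → Submodule K B} {i j m : ℕ}
    (h : i + j = m) {a : A} {b : B} (ha : a ∈ F i) (hb : b ∈ G j) :
    a ⊗ₜ[K] b ∈ fprod F G m := by
  subst h
  have hle : LinearMap.range (TensorProduct.map (F i).subtype (G (i + j - i)).subtype)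
      ≤ fprod F G (i + j) :=
    le_iSup₂_of_le i (Finset.mem_range.2 (by omega)) le_rfl
  apply hle
  have hb' : b ∈ G (i + j - i) := by simpa using hb
  exact ⟨(⟨a, ha⟩ : F i) ⊗ₜ (⟨b, hb'⟩ : G (i + j - i)), by simp⟩

lemma fprod_le {F : ℕ → Submodule K A} {G : ℕ → Submodule K B} {m : ℕ}
    {S : Submodule K (A ⊗[K] B)}
    (h : ∀ i j, i + j = m → ∀ a ∈ F i, ∀ b ∈ G j, a ⊗ₜ[K] b ∈ S) : fprod F G m ≤ S := by
  refine iSup₂_le fun i hi => ?_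
  rintro _ ⟨z, rfl⟩
  have hi' := Finset.mem_range.1 hi
  induction z with
  | zero => simp
  | tmul x y =>
    simp only [TensorProduct.map_tmul, Submodule.subtype_apply]
    exact h i (m - i) (by omega) _ x.2 _ y.2
  | add x y hx hy => rw [map_add]; exact S.add_mem hx hy

def Filt (G : ℕ → Submodule K C) : Prop :=
  ∀ m, ∀ x ∈ G m, Coalgebra.comul (R := K) x ∈ fprod G G m

def Van (G : ℕ → Submodule K C) (f : C →ₗ[K] V) (k : ℕ) : Prop :=
  ∀ j < k, ∀ x ∈ G j, f x = 0

lemma Van.conv {G : ℕ → Submodule K C} (hG : Filt G) {f : C →ₗ[K] V} {g : C →ₗ[K] W} {j k : ℕ}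
    (hf : Van G f j) (hg : Van G g k) :
    Van G (TensorProduct.map f g ∘ₗ Coalgebra.comul (R := K)) (j + k) := by
  intro m hm x hx
  have : fprod G G m ≤ LinearMap.ker (TensorProduct.map f g) := by
    refine fprod_le fun i l hil a ha b hb => ?_
    rw [LinearMap.mem_ker, TensorProduct.map_tmul]
    by_cases h : i < j
    · rw [hf i h a ha, zero_tmul]
    · rw [hg l (by omega) b hb, tmul_zero]
  exact this (hG m x hx)

lemma Van.add {G : ℕ → Submodule K C} {f g : C →ₗ[K] V} {k : ℕ} (hf : Van G f k) (hg : Van G g k) :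
    Van G (f + g) k := fun j hj x hx => by simp [hf j hj x hx, hg j hj x hx]

lemma Van.neg {G : ℕ → Submodule K C} {f : C →ₗ[K] V} {k : ℕ} (hf : Van G f k) :
    Van G (-f) k := fun j hj x hx => by simp [hf j hj x hx]

lemma Van.comp {G : ℕ → Submodule K C} {f : C →ₗ[K] V} {k : ℕ} (hf : Van G f k) (g : V →ₗ[K] W) :
    Van G (g ∘ₗ f) k := fun j hj x hx => by simp [hf j hj x hx]

lemma Van.mono {G : ℕ → Submodule K C} {f : C →ₗ[K] V} {k l : ℕ} (hf : Van G f k) (h : l ≤ k) :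
    Van G f l := fun j hj x hx => hf j (by omega) x hx

lemma fprod_map {F : ℕ → Submodule K A} {G : ℕ → Submodule K B} {F' : ℕ → Submodule K A'}
    {G' : ℕ → Submodule K B'} {f : A →ₗ[K] A'} {g : B →ₗ[K] B'}
    (hf : ∀ m, ∀ x ∈ F m, f x ∈ F' m) (hg : ∀ m, ∀ x ∈ G m, g x ∈ G' m) (m : ℕ) :
    ∀ z ∈ fprod F G m, TensorProduct.map f g z ∈ fprod F' G' m := by
  intro z hz
  have : fprod F G m ≤ (fprod F' G' m).comap (TensorProduct.map f g) :=
    fprod_le fun i j hij a ha b hb => by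
      rw [Submodule.mem_comap, TensorProduct.map_tmul]
      exact fprod_tmul_mem hij (hf _ _ ha) (hg _ _ hb)
  exact this hz

lemma Filt.tensor {D : Type} [AddCommGroup D] [Module K D] [Coalgebra K D]
    {F : ℕ → Submodule K C} {G : ℕ → Submodule K D} (hF : Filt F) (hG : Filt G) :
    Filt (K := K) (C := C ⊗[K] D) (fprod F G) := by
  intro m x hx
  have key : fprod F G m ≤ (fprod (fprod F G) (fprod F G) m).comap
      (Coalgebra.comul (R := K) (A := C ⊗[K] D)) := by
    refine fprod_le fun i j hij a ha b hb => ?_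
    rw [Submodule.mem_comap, TensorProduct.comul_tmul]
    have h1 : ∀ z ∈ fprod F F i, ∀ y ∈ fprod G G j,
        AlgebraTensorModule.tensorTensorTensorComm K K K K C C D D (z ⊗ₜ[K] y) ∈
          fprod (fprod F G) (fprod F G) m := by
      intro z hz
      have h2 : ∀ y, y ∈ fprod G G j → z ∈ (fprod (fprod F G) (fprod F G) m).comap
          ((AlgebraTensorModule.tensorTensorTensorComm K K K K C C D D).toLinearMap ∘ₗ
            (TensorProduct.mk K _ _).flip y) := by
        intro y hy
        revert z
        change fprod F F i ≤ _
        refine fprod_le fun p q hpq a ha b hb => ?_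
        have h3 : fprod G G j ≤ (fprod (fprod F G) (fprod F G) m).comap
          ((AlgebraTensorModule.tensorTensorTensorComm K K K K C C D D).toLinearMap ∘ₗ
            (TensorProduct.mk K _ _) (a ⊗ₜ b)) := by
          refine fprod_le fun r s hrs c hc d hd => ?_
          change (a ⊗ₜ[K] c) ⊗ₜ[K] (b ⊗ₜ[K] d) ∈ fprod (fprod F G) (fprod F G) m
          exact fprod_tmul_mem (i := p + r) (j := q + s) (by omega) (fprod_tmul_mem rfl ha hc)
            (fprod_tmul_mem rfl hb hd)
        exact h3 hy
      exact h2
    exact h1 _ (hF i a ha) _ (hG j b hb)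
  exact key hx

lemma tmap_sub_left (f f' : A →ₗ[K] A') (g : B →ₗ[K] B') :
    TensorProduct.map (f - f') g = TensorProduct.map f g - TensorProduct.map f' g := by
  ext; simp [sub_tmul]

lemma tmap_sub_right (f : A →ₗ[K] A') (g g' : B →ₗ[K] B') :
    TensorProduct.map f (g - g') = TensorProduct.map f g - TensorProduct.map f g' := by
  ext; simp [tmul_sub]

/-- generalized inverse -/
lemma exists_ginv (f : V →ₗ[K] W) : ∃ s : W →ₗ[K] V, f ∘ₗ s ∘ₗ f = f := by
  obtain ⟨g, hg⟩ := LinearMap.exists_rightInverse_of_surjective f.rangeRestrict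
    (LinearMap.range_rangeRestrict f)
  obtain ⟨s, hs⟩ := LinearMap.exists_extend g
  refine ⟨s, LinearMap.ext fun x => ?_⟩
  have h1 : s (f x) = g (f.rangeRestrict x) := by
    rw [← hs]; rfl
  have h2 := LinearMap.congr_fun hg (f.rangeRestrict x)
  simp only [LinearMap.comp_apply, h1]
  exact congrArg Subtype.val h2

lemma lattice (F : ℕ → Submodule K V) (Q : ℕ → V →ₗ[K] V) (h0 : Q 0 = LinearMap.id)
    (hQ : ∀ k x, x - Q (k + 1) x ∈ F k) (hs : ∀ k, ∃ t : V →ₗ[K] V, Q (k + 1) = t ∘ₗ Q k)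
    (m : ℕ) (z : V ⊗[K] V) (hz : ∀ k l, k + l = m + 1 → TensorProduct.map (Q k) (Q l) z = 0)
    (hF : Monotone F) :
    z ∈ fprod F F m := by
  have hz2 : ∀ k l, k + l = m + 2 → 1 ≤ l → TensorProduct.map (Q k) (Q l) z = 0 := by
    intro k l hkl hl
    obtain ⟨l, rfl⟩ : ∃ l', l = l' + 1 := ⟨l - 1, by omega⟩
    obtain ⟨t, ht⟩ := hs l
    have := hz k l (by omega)
    rw [ht, ← LinearMap.id_comp (Q k), TensorProduct.map_comp, LinearMap.comp_apply, this, map_zero]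
  have step : ∀ a ≤ m, TensorProduct.map (Q a - Q (a + 1)) LinearMap.id z ∈ fprod F F m := by
    intro a ha
    have e : (LinearMap.id : V →ₗ[K] V) = (LinearMap.id - Q (m - a + 1)) + Q (m - a + 1) := by simp
    rw [e, TensorProduct.map_add_right, LinearMap.add_apply]
    have e2 : TensorProduct.map (Q a - Q (a + 1)) (Q (m - a + 1)) z = 0 := by
      rw [tmap_sub_left, LinearMap.sub_apply, hz _ _ (by omega),
        hz2 _ _ (by omega) (by omega), sub_zero]
    rw [e2, add_zero]
    clear e2 e hz hz2
    induction z with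
    | zero => simp
    | tmul x y =>
      rw [TensorProduct.map_tmul]
      refine fprod_tmul_mem (i := a) (j := m - a) (by omega) ?_ (by simpa using hQ _ y)
      have h1 := hQ a x
      rcases a with _ | a
      · simpa [h0] using h1
      · have h2 := hF (Nat.le_succ a) (hQ a x)
        have := Submodule.sub_mem _ h1 h2
        simpa using this
    | add x y hx hy => rw [map_add]; exact Submodule.add_mem _ hx hy
  have tel : ∀ k ≤ m + 1, z - TensorProduct.map (Q k) LinearMap.id z ∈ fprod F F m := by
    intro k
    induction k with
    | zero => intro _; simp [h0]
    | succ k ih =>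
      intro hk
      have h1 := ih (by omega)
      have h2 := step k (by omega)
      rw [tmap_sub_left, LinearMap.sub_apply] at h2
      simpa using Submodule.add_mem _ h1 h2
  have h1 := tel (m + 1) le_rfl
  have h2 := hz (m + 1) 0 (by omega)
  rw [h0] at h2
  simpa [h2] using h1
end gen

lemma projAug_one : projAug K H 1 = 0 := by simp [projAug]

lemma redDelta_succ (m : ℕ) : redDelta K H (m + 1) =
    (TensorProduct.map (projAug K H) (redDelta K H m)) ∘ₗ Coalgebra.comul (R := K) (A := H) := rfl

lemma eq_of_projAug (x : H) : x = projAug K H x + algebraMap K H (Coalgebra.counit (R := K) x) := by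
  simp [projAug]

section gen2
variable {V W U A : Type} [AddCommGroup V] [Module K V] [AddCommGroup W] [Module K W]
  [AddCommGroup U] [Module K U] [AddCommGroup A] [Module K A] [Coalgebra K A]

lemma gen_one (f : H →ₗ[K] V) :
    (TensorProduct.map (projAug K H) f ∘ₗ Coalgebra.comul (R := K) (A := H)) 1 = 0 := by
  rw [LinearMap.comp_apply, Bialgebra.comul_one, Algebra.TensorProduct.one_def,
      TensorProduct.map_tmul, projAug_one, zero_tmul]

lemma gen_step (p : A →ₗ[K] U) (f : A →ₗ[K] V) (f' : A →ₗ[K] W) (t : V →ₗ[K] W) (h : f' = t ∘ₗ f) :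
    TensorProduct.map p f' ∘ₗ Coalgebra.comul (R := K) (A := A) =
    TensorProduct.map (LinearMap.id (R := K) (M := U)) t ∘ₗ
      (TensorProduct.map p f ∘ₗ Coalgebra.comul (R := K) (A := A)) := by
  rw [h, ← LinearMap.comp_assoc, ← TensorProduct.map_comp, LinearMap.id_comp]

lemma gen_assoc (p : A →ₗ[K] U) (f : A →ₗ[K] V) (g : A →ₗ[K] W) :
    TensorProduct.map (TensorProduct.map p f ∘ₗ Coalgebra.comul (R := K) (A := A)) g ∘ₗ
      Coalgebra.comul (R := K) (A := A) =
    (TensorProduct.assoc K U V W).symm.toLinearMap ∘ₗ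
     (TensorProduct.map p (TensorProduct.map f g ∘ₗ Coalgebra.comul (R := K) (A := A)) ∘ₗ
      Coalgebra.comul (R := K) (A := A)) := by
  have e2 : TensorProduct.map (TensorProduct.map p f ∘ₗ Coalgebra.comul (R := K) (A := A)) g ∘ₗ
        Coalgebra.comul (R := K) (A := A) =
        (TensorProduct.map (TensorProduct.map p f) g) ∘ₗ
        (Coalgebra.comul (R := K) (A := A)).rTensor A ∘ₗ Coalgebra.comul (R := K) (A := A) := by
    conv_lhs => rw [← LinearMap.comp_id g, TensorProduct.map_comp]
    rfl
  have e3 : TensorProduct.map p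
          (TensorProduct.map f g ∘ₗ Coalgebra.comul (R := K) (A := A)) ∘ₗ
          Coalgebra.comul (R := K) (A := A) = TensorProduct.map p
          (TensorProduct.map f g) ∘ₗ
          (Coalgebra.comul (R := K) (A := A)).lTensor A ∘ₗ Coalgebra.comul (R := K) (A := A) := by
    conv_lhs => rw [← LinearMap.comp_id p, TensorProduct.map_comp]
    rfl
  have e4 : ∀ z : (A ⊗[K] A) ⊗[K] A,
        TensorProduct.map (TensorProduct.map p f) g z =
        (TensorProduct.assoc K U V W).symm (TensorProduct.map p
          (TensorProduct.map f g) (TensorProduct.assoc K A A A z)) := by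
    intro z
    induction z with
    | zero => simp
    | add x y hx hy => rw [map_add, hx, hy]; simp only [map_add]
    | tmul x y =>
      induction x with
      | zero => simp
      | add x y hx hy => rw [add_tmul, map_add, hx, hy]; simp only [map_add]
      | tmul x y => rfl
  rw [e2, e3]
  ext x
  simp only [LinearMap.comp_apply, e4, Coalgebra.coassoc_apply, LinearEquiv.coe_coe]

end gen2

lemma redDelta_one (m : ℕ) : redDelta K H m 1 = 0 := by
  cases m with
  | zero => exact (projAug_one : projAug K H 1 = 0)
  | succ m =>
    exact gen_one _

lemma redDelta_algebraMap (m : ℕ) (c : K) : redDelta K H m (algebraMap K H c) = 0 := by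
  rw [Algebra.algebraMap_eq_smul_one, map_smul, redDelta_one, smul_zero]

lemma redDelta_proj (m : ℕ) : redDelta K H m = redDelta K H m ∘ₗ projAug K H := by
  ext x
  conv_lhs => rw [eq_of_projAug (K := K) x, map_add, redDelta_algebraMap, add_zero]
  rfl

lemma primFil_eq (m : ℕ) : primFil K H m = LinearMap.ker (redDelta K H m) := by
  apply le_antisymm
  · refine sup_le ?_ inf_le_right
    rw [Submodule.span_le, Set.singleton_subset_iff]
    exact redDelta_one m
  · intro x hx
    rw [eq_of_projAug (K := K) x]
    refine Submodule.add_mem _ (Submodule.mem_sup_right ⟨?_, ?_⟩) (Submodule.mem_sup_left ?_)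
    · simp [projAug]
    · rw [redDelta_proj] at hx; exact hx
    · rw [Algebra.algebraMap_eq_smul_one]
      exact Submodule.smul_mem _ _ (Submodule.mem_span_singleton_self _)

lemma redDelta_step (m : ℕ) : ∃ t : TPow K H m →ₗ[K] TPow K H (m + 1),
    redDelta K H (m + 1) = t ∘ₗ redDelta K H m := by
  induction m with
  | zero => exact ⟨redDelta K H 1, redDelta_proj 1⟩
  | succ m ih =>
    obtain ⟨t, ht⟩ := ih
    exact ⟨TensorProduct.map (LinearMap.id (R := K) (M := H)) t, gen_step _ _ _ t ht⟩

lemma redDelta_mono {m k : ℕ} (h : m ≤ k) {x : H} (hx : redDelta K H m x = 0) :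
    redDelta K H k x = 0 := by
  induction k, h using Nat.le_induction with
  | base => exact hx
  | succ k _ ih =>
    obtain ⟨t, ht⟩ := redDelta_step (K := K) (H := H) k
    rw [ht, LinearMap.comp_apply, ih, map_zero]

lemma redDelta_split (a : ℕ) : ∀ b c, c = a + b + 1 →
    ∃ t : TPow K H c →ₗ[K] (TPow K H a) ⊗[K] (TPow K H b),
    TensorProduct.map (redDelta K H a) (redDelta K H b) ∘ₗ Coalgebra.comul (R := K) =
      t ∘ₗ redDelta K H c := by
  induction a with
  | zero =>
    rintro b c hc
    obtain rfl : c = b + 1 := by omega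
    exact ⟨LinearMap.id, rfl⟩
  | succ a ih =>
    rintro b c hc
    obtain rfl : c = (a + b + 1) + 1 := by omega
    obtain ⟨t, ht⟩ := ih b _ rfl
    refine ⟨(TensorProduct.assoc K H (TPow K H a) (TPow K H b)).symm.toLinearMap ∘ₗ
      TensorProduct.map (LinearMap.id (R := K) (M := H)) t, ?_⟩
    refine (gen_assoc (projAug K H) (redDelta K H a) (redDelta K H b)).trans ?_
    have := gen_step (projAug K H) _ _ t ht
    rw [this]
    rfl

lemma redDelta_left {m : ℕ} {x : H} (hx : redDelta K H m x = 0) :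
    TensorProduct.map (LinearMap.id (R := K) (M := H)) (redDelta K H m)
      (Coalgebra.comul (R := K) x) = 0 := by
  have e : (LinearMap.id (R := K) (M := H)) = projAug K H +
    Algebra.linearMap K H ∘ₗ (Coalgebra.counit (R := K) (A := H)) := by simp [projAug]
  have h1 : TensorProduct.map (projAug K H) (redDelta K H m) (Coalgebra.comul (R := K) x) = 0 :=
    redDelta_mono (Nat.le_succ m) hx
  have e2 : TensorProduct.map (Algebra.linearMap K H ∘ₗ (Coalgebra.counit (R := K) (A := H)))
      (redDelta K H m) = TensorProduct.map (Algebra.linearMap K H) (redDelta K H m) ∘ₗ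
        (Coalgebra.counit (R := K) (A := H)).rTensor H := by
    conv_lhs => rw [← LinearMap.comp_id (redDelta K H m), TensorProduct.map_comp]
    rfl
  rw [e, TensorProduct.map_add_left, LinearMap.add_apply, h1, zero_add, e2, LinearMap.comp_apply,
    Coalgebra.rTensor_counit_comul, TensorProduct.map_tmul, hx, tmul_zero]

lemma redDelta_right {m : ℕ} {x : H} (hx : redDelta K H m x = 0) :
    TensorProduct.map (redDelta K H m) (LinearMap.id (R := K) (M := H))
      (Coalgebra.comul (R := K) x) = 0 := by
  have e : (LinearMap.id (R := K) (M := H)) = projAug K H +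
    Algebra.linearMap K H ∘ₗ (Coalgebra.counit (R := K) (A := H)) := by simp [projAug]
  have h1 : TensorProduct.map (redDelta K H m) (projAug K H) (Coalgebra.comul (R := K) x) = 0 := by
    obtain ⟨t, ht⟩ := redDelta_split (K := K) (H := H) m 0 (m + 1) rfl
    have := LinearMap.congr_fun ht x
    simp only [LinearMap.comp_apply, redDelta_mono (Nat.le_succ m) hx, map_zero] at this
    exact this
  have e2 : TensorProduct.map (redDelta K H m) (Algebra.linearMap K H ∘ₗ (Coalgebra.counit (R := K) (A := H)))
       = TensorProduct.map (redDelta K H m) (Algebra.linearMap K H) ∘ₗ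
        (Coalgebra.counit (R := K) (A := H)).lTensor H := by
    conv_lhs => rw [← LinearMap.comp_id (redDelta K H m), TensorProduct.map_comp]
    rfl
  rw [e, TensorProduct.map_add_right, LinearMap.add_apply, h1, zero_add, e2, LinearMap.comp_apply,
    Coalgebra.lTensor_counit_comul, TensorProduct.map_tmul, hx, zero_tmul]

lemma primFil_filt : Filt (primFil K H) := by
  intro m x hx
  have hx' : redDelta K H m x = 0 := by rw [primFil_eq] at hx; exact hx
  choose s hs using fun k => exists_ginv (redDelta K H k)
  let Q : ℕ → H →ₗ[K] H := fun k => Nat.casesOn k LinearMap.id (fun k => s k ∘ₗ redDelta K H k)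
  refine lattice (primFil K H) Q rfl ?_ ?_ m _ ?_ ?_
  · intro k x
    rw [primFil_eq, LinearMap.mem_ker, map_sub]
    have := LinearMap.congr_fun (hs k) x
    exact sub_eq_zero.2 this.symm
  · intro k
    rcases k with _ | k
    · exact ⟨Q 1, rfl⟩
    · obtain ⟨t, ht⟩ := redDelta_step (K := K) (H := H) k
      refine ⟨s (k + 1) ∘ₗ t ∘ₗ redDelta K H k, ?_⟩
      change s (k + 1) ∘ₗ redDelta K H (k + 1) = _
      rw [ht]
      conv_lhs => rw [← hs k]
      rfl
  · intro k l hkl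
    rcases k with _ | k
    · obtain rfl : l = m + 1 := by omega
      change TensorProduct.map LinearMap.id (s m ∘ₗ redDelta K H m) _ = 0
      rw [← LinearMap.id_comp LinearMap.id, TensorProduct.map_comp, LinearMap.comp_apply,
        redDelta_left hx', map_zero]
    · rcases l with _ | l
      · obtain rfl : k = m := by omega
        change TensorProduct.map (s k ∘ₗ redDelta K H k) LinearMap.id _ = 0
        rw [← LinearMap.id_comp LinearMap.id, TensorProduct.map_comp, LinearMap.comp_apply,
          redDelta_right hx', map_zero]
      · obtain rfl : m = k + l + 1 := by omega
        change TensorProduct.map (s k ∘ₗ redDelta K H k) (s l ∘ₗ redDelta K H l) _ = 0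
        obtain ⟨t, ht⟩ := redDelta_split (K := K) (H := H) k l _ rfl
        have := LinearMap.congr_fun ht x
        simp only [LinearMap.comp_apply, hx', map_zero] at this
        rw [TensorProduct.map_comp, LinearMap.comp_apply, this, map_zero]
  · intro a b hab x hx
    rw [primFil_eq, LinearMap.mem_ker] at *
    exact redDelta_mono hab hx

lemma filHTPow_filt (n : ℕ) : Filt (filHTPow K H n) := by
  induction n with
  | zero =>
    intro m x _
    change K at x
    change (1 : K) ⊗ₜ[K] x ∈ _
    exact fprod_tmul_mem (i := 0) (j := m) (by omega) trivial trivial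
  | succ n ih => exact Filt.tensor (primFil_filt (K := K) (H := H)) ih

section fin
variable {C : Type} [AddCommGroup C] [Module K C] [Coalgebra K C]

lemma gen_coalg {V U : Type} [AddCommGroup V] [Module K V] [AddCommGroup U] [Module K U]
    {φ : C →ₗ[K] H} (h : IsCoalgMor K φ)
    (p : H →ₗ[K] U) (f : H →ₗ[K] V) :
    (TensorProduct.map p f ∘ₗ Coalgebra.comul (R := K) (A := H)) ∘ₗ φ =
      TensorProduct.map (p ∘ₗ φ) (f ∘ₗ φ) ∘ₗ Coalgebra.comul (R := K) (A := C) := by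
  rw [LinearMap.comp_assoc, h.2, ← LinearMap.comp_assoc, ← TensorProduct.map_comp]

lemma projAug_comp {φ : C →ₗ[K] H} (h : IsCoalgMor K φ) :
    projAug K H ∘ₗ φ = φ - convUnit K H C := by
  ext x
  have := LinearMap.congr_fun h.1 x
  simp only [LinearMap.comp_apply] at this
  simp [projAug, convUnit, this]

lemma van_A {G : ℕ → Submodule K C} (hG : Filt G) {φ : C →ₗ[K] H} (h : IsCoalgMor K φ)
    (h1 : Van G (projAug K H ∘ₗ φ) 1) (m : ℕ) : Van G (redDelta K H m ∘ₗ φ) (m + 1) := by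
  induction m with
  | zero => exact h1
  | succ m ih =>
    have := Van.conv hG h1 ih
    rw [← gen_coalg h, add_comm] at this
    exact this

lemma van_B_step {V U : Type} [AddCommGroup V] [Module K V] [AddCommGroup U] [Module K U]
    {G : ℕ → Submodule K C} (hG : Filt G) {φ ψ : C →ₗ[K] H}
    (h : IsCoalgMor K φ) (h' : IsCoalgMor K ψ) (p : H →ₗ[K] U) (f : H →ₗ[K] V) {k : ℕ}
    (h1 : Van G (p ∘ₗ ψ) 1) (h2 : Van G (p ∘ₗ φ - p ∘ₗ ψ) 2)
    (h3 : Van G (f ∘ₗ φ) k) (h4 : Van G (f ∘ₗ φ - f ∘ₗ ψ) (k + 1)) :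
    Van G ((TensorProduct.map p f ∘ₗ Coalgebra.comul (R := K) (A := H)) ∘ₗ φ -
      (TensorProduct.map p f ∘ₗ Coalgebra.comul (R := K) (A := H)) ∘ₗ ψ) (k + 2) := by
  have a := (Van.conv hG h2 h3).mono (l := k + 2) (by omega)
  have b := (Van.conv hG h1 h4).mono (l := k + 2) (by omega)
  have c := a.add b
  rw [tmap_sub_left, tmap_sub_right, ← LinearMap.add_comp, sub_add_sub_cancel,
    LinearMap.sub_comp, ← gen_coalg h, ← gen_coalg h'] at c
  exact c

lemma van_B {G : ℕ → Submodule K C} (hG : Filt G) {φ ψ : C →ₗ[K] H} (h : IsCoalgMor K φ)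
    (h' : IsCoalgMor K ψ)
    (h1 : Van G (projAug K H ∘ₗ φ) 1) (h1' : Van G (projAug K H ∘ₗ ψ) 1)
    (h2 : Van G (projAug K H ∘ₗ φ - projAug K H ∘ₗ ψ) 2) (m : ℕ) :
    Van G (redDelta K H m ∘ₗ φ - redDelta K H m ∘ₗ ψ) (m + 2) := by
  induction m with
  | zero => exact h2
  | succ m ih => exact van_B_step hG h h' _ _ h1' h2 (van_A hG h h1 m) ih

lemma conv_eq (f g : C →ₗ[K] H) : conv K H C f g - convUnit K H C =
    (f - convUnit K H C) + (g - convUnit K H C) +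
      conv K H C (f - convUnit K H C) (g - convUnit K H C) := by
  have e1 : ∀ f, conv K H C f (convUnit K H C) = f := by
    intro f
    have e : TensorProduct.map f (convUnit K H C) =
      TensorProduct.map f (Algebra.linearMap K H) ∘ₗ
        (Coalgebra.counit (R := K) (A := C)).lTensor C := by
      conv_lhs => rw [← LinearMap.comp_id f, convUnit, TensorProduct.map_comp]
      rfl
    ext x
    simp only [conv, LinearMap.comp_apply]
    rw [e, LinearMap.comp_apply, Coalgebra.lTensor_counit_comul]
    simp
  have e2 : ∀ f, conv K H C (convUnit K H C) f = f := by
    intro f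
    have e : TensorProduct.map (convUnit K H C) f =
      TensorProduct.map (Algebra.linearMap K H) f ∘ₗ
        (Coalgebra.counit (R := K) (A := C)).rTensor C := by
      conv_lhs => rw [← LinearMap.comp_id f, convUnit, TensorProduct.map_comp]
      rfl
    ext x
    simp only [conv, LinearMap.comp_apply]
    rw [e, LinearMap.comp_apply, Coalgebra.rTensor_counit_comul]
    simp
  have e3 : conv K H C (f - convUnit K H C) (g - convUnit K H C) =
      conv K H C f g - conv K H C f (convUnit K H C) - (conv K H C (convUnit K H C) g -
      conv K H C (convUnit K H C) (convUnit K H C)) := by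
    simp only [conv, tmap_sub_left, tmap_sub_right, LinearMap.sub_comp, LinearMap.comp_sub]
    abel
  rw [e3, e1, e1, e2]
  abel

def shift {A : Type} [AddCommGroup A] [Module K A] (F : ℕ → Submodule K A) (m : ℕ) :
    Submodule K A := Nat.casesOn m ⊥ F

lemma shift_left {A B : Type} [AddCommGroup A] [Module K A] [AddCommGroup B] [Module K B]
    (F : ℕ → Submodule K A) (G : ℕ → Submodule K B) (m : ℕ) :
    fprod (shift F) G m ≤ shift (fprod F G) m := by
  refine fprod_le fun i j hij a ha b hb => ?_
  rcases i with _ | i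
  · obtain rfl : a = 0 := by simpa [shift] using ha
    rw [zero_tmul]; exact Submodule.zero_mem _
  · obtain rfl : m = (i + j) + 1 := by omega
    exact fprod_tmul_mem (F := F) (G := G) rfl ha hb

lemma shift_right {A B : Type} [AddCommGroup A] [Module K A] [AddCommGroup B] [Module K B]
    (F : ℕ → Submodule K A) (G : ℕ → Submodule K B) (m : ℕ) :
    fprod F (shift G) m ≤ shift (fprod F G) m := by
  refine fprod_le fun i j hij a ha b hb => ?_
  rcases j with _ | j
  · obtain rfl : b = 0 := by simpa [shift] using hb
    rw [tmul_zero]; exact Submodule.zero_mem _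
  · obtain rfl : m = (i + j) + 1 := by omega
    exact fprod_tmul_mem (F := F) (G := G) rfl ha hb

def MM (n : ℕ) (f : Fin n → (C →ₗ[K] H)) : C →ₗ[K] (HTPow K H n).carrier :=
  multiMap K H C n f ∘ₗ deltaIter K C n

lemma MM_succ (n : ℕ) (f : Fin (n + 1) → (C →ₗ[K] H)) : MM (n + 1) f =
    (TensorProduct.map (f 0) (MM n (fun j => f j.succ)) ∘ₗ Coalgebra.comul (R := K) (A := C) :
      C →ₗ[K] H ⊗[K] (HTPow K H n).carrier) := by
  have e : TensorProduct.map (f 0) (MM n (fun j => f j.succ)) =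
    TensorProduct.map (f 0) (multiMap K H C n (fun j => f j.succ)) ∘ₗ
      TensorProduct.map LinearMap.id (deltaIter K C n) := by
    rw [← TensorProduct.map_comp]; rfl
  rw [e]
  rfl

lemma tmap_tele {A B A' B' : Type} [AddCommGroup A] [Module K A] [AddCommGroup B] [Module K B]
    [AddCommGroup A'] [Module K A'] [AddCommGroup B'] [Module K B']
    (f f' : A →ₗ[K] A') (g g' : B →ₗ[K] B') (z : A ⊗[K] B) :
    TensorProduct.map (f - f') g z + TensorProduct.map f' (g - g') z =
      TensorProduct.map f g z - TensorProduct.map f' g' z := by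
  rw [tmap_sub_left, tmap_sub_right, ← LinearMap.add_apply, sub_add_sub_cancel,
    LinearMap.sub_apply]

lemma MM_mem {G : ℕ → Submodule K C} (hG : Filt G) (n : ℕ) (f : Fin n → (C →ₗ[K] H))
    (hf : ∀ i m, ∀ x ∈ G m, f i x ∈ primFil K H m) (m : ℕ) (x : C) (hx : x ∈ G m) :
    MM n f x ∈ filHTPow K H n m := by
  induction n generalizing m x with
  | zero => trivial
  | succ n ih =>
    rw [MM_succ]
    exact fprod_map (F' := primFil K H) (G' := filHTPow K H n) (hf 0)
      (ih _ (fun i => hf i.succ)) m _ (hG m x hx)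

lemma MM_sub {G : ℕ → Submodule K C} (hG : Filt G) (n : ℕ) (f g : Fin n → (C →ₗ[K] H))
    (hf : ∀ i m, ∀ x ∈ G m, f i x ∈ primFil K H m)
    (hg : ∀ i m, ∀ x ∈ G m, g i x ∈ primFil K H m)
    (hfg : ∀ i m, ∀ x ∈ G m, (f i - g i) x ∈ shift (primFil K H) m)
    (m : ℕ) (x : C) (hx : x ∈ G m) :
    (MM n f - MM n g) x ∈ shift (filHTPow K H n) m := by
  induction n generalizing m x with
  | zero =>
    have : MM 0 f = MM 0 g := rfl
    rw [this, sub_self]; exact Submodule.zero_mem _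
  | succ n ih =>
    have a := shift_left _ _ _ (fprod_map (F' := shift (primFil K H)) (G' := filHTPow K H n) (hfg 0)
      (MM_mem hG n _ (fun i => hf i.succ)) m _ (hG m x hx))
    have b := shift_right _ _ _ (fprod_map (F' := primFil K H) (G' := shift (filHTPow K H n)) (hg 0)
      (ih _ _ (fun i => hf i.succ) (fun i => hg i.succ) (fun i => hfg i.succ)) m _ (hG m x hx))
    have c := Submodule.add_mem _ a b
    rw [tmap_tele] at c
    rw [MM_succ, MM_succ]
    exact c

end fin

lemma proj_zero_gen {D : Type} [AddCommGroup D] [Module K D] [Coalgebra K D]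
    (G : ℕ → Submodule K D) (p : D →ₗ[K] H)
    (hp : ∀ y ∈ G 0, p y = algebraMap K H (Coalgebra.counit (R := K) y))
    (x : H ⊗[K] D) (hx : x ∈ fprod (primFil K H) G 0) :
    ((TensorProduct.rid K H).toLinearMap ∘ₗ
        TensorProduct.map LinearMap.id (Coalgebra.counit (R := K) (A := D))) x =
      convUnit K H (H ⊗[K] D) x ∧
    (p ∘ₗ ((TensorProduct.lid K D).toLinearMap ∘ₗ
        TensorProduct.map (Coalgebra.counit (R := K) (A := H)) LinearMap.id)) x =
      convUnit K H (H ⊗[K] D) x := by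
  have hF : ∀ a ∈ primFil K H 0, a = algebraMap K H (Coalgebra.counit (R := K) a) := by
    intro a ha
    rw [primFil_eq] at ha
    have ha' : projAug K H a = 0 := ha
    conv_lhs => rw [eq_of_projAug (K := K) a, ha', zero_add]
  constructor
  · rw [← sub_eq_zero, ← LinearMap.sub_apply, ← LinearMap.mem_ker]
    revert x
    refine fprod_le fun i j hij a ha b hb => ?_
    obtain ⟨rfl, rfl⟩ : i = 0 ∧ j = 0 := by omega
    have h1 := hF a ha
    rw [LinearMap.mem_ker, LinearMap.sub_apply, sub_eq_zero]
    simp only [convUnit, LinearMap.comp_apply, TensorProduct.map_tmul, LinearEquiv.coe_coe,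
      TensorProduct.rid_tmul, TensorProduct.counit_tmul, LinearMap.id_apply,
      Algebra.linearMap_apply, smul_eq_mul, map_mul]
    conv_lhs => rw [h1, Algebra.smul_def]
  · rw [← sub_eq_zero, ← LinearMap.sub_apply, ← LinearMap.mem_ker]
    revert x
    refine fprod_le fun i j hij a ha b hb => ?_
    obtain ⟨rfl, rfl⟩ : i = 0 ∧ j = 0 := by omega
    rw [LinearMap.mem_ker, LinearMap.sub_apply, sub_eq_zero]
    simp only [convUnit, LinearMap.comp_apply, TensorProduct.map_tmul, LinearEquiv.coe_coe,
      TensorProduct.lid_tmul, TensorProduct.counit_tmul, LinearMap.id_apply,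
      Algebra.linearMap_apply, smul_eq_mul, map_mul, map_smul, hp b hb, Algebra.smul_def]
    simp [mul_comm, ← map_mul]

lemma proj_zero (n : ℕ) (i : Fin n) (x : (HTPow K H n).carrier) (hx : x ∈ filHTPow K H n 0) :
    proj K H n i x = convUnit K H _ x := by
  induction n with
  | zero => exact i.elim0
  | succ n ih =>
    refine Fin.cases ?_ (fun j => ?_) i
    · exact (proj_zero_gen (filHTPow K H n) (convUnit K H _) (fun y hy => rfl) x hx).1
    · exact (proj_zero_gen (filHTPow K H n) (proj K H n j) (fun y hy => ih j y hy) x hx).2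

section main
variable {C : Type} [AddCommGroup C] [Module K C] [Coalgebra K C]

lemma u_van1 {ι : Type} {G : ℕ → Submodule K C} (hG : Filt G) (w : FreeGroup ι → (C →ₗ[K] H))
    (hw1 : ∀ a b, w (a * b) = conv K H _ (w a) (w b))
    (hw2 : w 1 = convUnit K H _)
    (hw3 : ∀ i, ∀ x ∈ G 0, w (FreeGroup.of i) x = convUnit K H _ x) (a : FreeGroup ι) :
    Van G (w a - convUnit K H C) 1 := by
  have hc : ∀ {f g : C →ₗ[K] H} {j k}, Van G f j → Van G g k → Van G (conv K H C f g) (j + k) :=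
    fun hf hg => (Van.conv hG hf hg).comp _
  induction a using FreeGroup.induction_on with
  | C1 => rw [hw2, sub_self]; intro j hj x hx; rfl
  | of i =>
    intro j hj x hx
    obtain rfl : j = 0 := by omega
    rw [LinearMap.sub_apply, sub_eq_zero]
    exact hw3 i x hx
  | inv_of i ih =>
    have h := conv_eq (w (FreeGroup.of i)) (w (FreeGroup.of i)⁻¹)
    rw [← hw1, mul_inv_cancel, hw2, sub_self] at h
    have e : w (FreeGroup.of i)⁻¹ - convUnit K H C = -((w (FreeGroup.of i) - convUnit K H C) +
      conv K H C (w (FreeGroup.of i) - convUnit K H C) (w (FreeGroup.of i)⁻¹ - convUnit K H C)) := by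
      rw [eq_neg_iff_add_eq_zero, h]; abel
    have h0 : Van G (w (FreeGroup.of i)⁻¹ - convUnit K H C) 0 := fun j hj => by omega
    have := (ih.add (hc ih h0)).neg
    rw [← e] at this
    exact this
  | mul a b ha hb =>
    rw [hw1, conv_eq]
    exact (ha.add hb).add ((hc ha hb).mono (by omega))

lemma u_ab {ι : Type} {G : ℕ → Submodule K C} (hG : Filt G) (w : FreeGroup ι → (C →ₗ[K] H))
    (hw1 : ∀ a b, w (a * b) = conv K H _ (w a) (w b))
    (h1 : ∀ a, Van G (w a - convUnit K H C) 1) (a b : FreeGroup ι)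
    (hab : Abelianization.of a = Abelianization.of b) :
    Van G ((w a - convUnit K H C) - (w b - convUnit K H C)) 2 := by
  have key : ∀ x ∈ G 1, (w a - convUnit K H C) x = (w b - convUnit K H C) x := by
    intro x hx
    let θ : FreeGroup ι →* Multiplicative H := MonoidHom.mk'
      (fun a => Multiplicative.ofAdd ((w a - convUnit K H C) x)) (by
        intro a b
        rw [← ofAdd_add, hw1, conv_eq]
        have : conv K H C (w a - convUnit K H C) (w b - convUnit K H C) x = 0 :=
          ((Van.conv hG (h1 a) (h1 b)).comp (LinearMap.mul' K H)) 1 (by omega) x hx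
        rw [LinearMap.add_apply, this, add_zero, LinearMap.add_apply])
    have h := congrArg (Abelianization.lift θ) hab
    rw [Abelianization.lift_apply_of, Abelianization.lift_apply_of] at h
    exact h
  intro j hj x hx
  rcases j with _ | j
  · rw [LinearMap.sub_apply, h1 a 0 (by omega) x hx, h1 b 0 (by omega) x hx, sub_zero]
  · obtain rfl : j = 0 := by omega
    rw [LinearMap.sub_apply, key x hx, sub_self]

end main
end helpers

/-- (Proposition 2.2 and Theorem 1.2, degree-zero case.)
(i) The right action `T` of `End(F_n)` on `H^{⊗n}` preserves the filtration induced by the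
primitive filtration; (ii) if `K` has characteristic `0`, `H` is connected, and
`Ψ₁, Ψ₂ ∈ End(F_n)` induce the same endomorphism of `F_n^{ab} ≅ ℤⁿ`, then
`(T(Ψ₁) − T(Ψ₂))(F_m(H^{⊗n})) ⊆ F_{m−1}(H^{⊗n})` for `m ≥ 1`; i.e. the induced action on
the associated graded factors through `End(ℤⁿ)`. -/
theorem stmt_3 (hcc : IsCocomm K H) (n : ℕ) (hn : 1 ≤ n)
    (w : FreeGroup (Fin n) → ((HTPow K H n).carrier →ₗ[K] H))
    (hw0 : ∀ a, IsCoalgMor K (w a))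
    (hw1 : ∀ a b, w (a * b) = conv K H _ (w a) (w b))
    (hw2 : w 1 = convUnit K H _)
    (hw3 : ∀ i : Fin n, w (FreeGroup.of i) = proj K H n i)
    (T : (FreeGroup (Fin n) →* FreeGroup (Fin n)) →
      ((HTPow K H n).carrier →ₗ[K] (HTPow K H n).carrier))
    (hT : ∀ Ψ, T Ψ = (multiMap K H _ n (fun i => w (Ψ (FreeGroup.of i)))) ∘ₗ
      (deltaIter K (HTPow K H n).carrier n)) :
    -- (i) `T(Ψ)` preserves the filtration
    (∀ (Ψ : FreeGroup (Fin n) →* FreeGroup (Fin n)) (m : ℕ)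
        (x : (HTPow K H n).carrier),
      x ∈ filHTPow K H n m → T Ψ x ∈ filHTPow K H n m) ∧
    -- (ii) on the associated graded the action factors through `End(ℤⁿ)`
    (CharZero K →
      (∀ x : H, ∃ m : ℕ, x ∈ primFil K H m) →
      ∀ Ψ₁ Ψ₂ : FreeGroup (Fin n) →* FreeGroup (Fin n),
        Abelianization.map Ψ₁ = Abelianization.map Ψ₂ →
        ∀ (m : ℕ), 1 ≤ m → ∀ x : (HTPow K H n).carrier,
          x ∈ filHTPow K H n m → T Ψ₁ x - T Ψ₂ x ∈ filHTPow K H n (m - 1)) := by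
  have hG := filHTPow_filt (K := K) (H := H) n
  have h1 : ∀ a, Van (filHTPow K H n) (w a - convUnit K H _) 1 :=
    u_van1 hG w hw1 hw2 (fun i x hx => by rw [hw3]; exact proj_zero n i x hx)
  have h1' : ∀ a, Van (filHTPow K H n) (projAug K H ∘ₗ w a) 1 := fun a => by
    rw [projAug_comp (hw0 a)]; exact h1 a
  have hmem : ∀ a m, ∀ x ∈ filHTPow K H n m, w a x ∈ primFil K H m := by
    intro a m x hx
    rw [primFil_eq]
    exact van_A hG (hw0 a) (h1' a) m m (by omega) x hx
  refine ⟨fun Ψ m x hx => ?_, fun _ _ Ψ₁ Ψ₂ hΨ m hm x hx => ?_⟩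
  · rw [hT]
    exact MM_mem hG n _ (fun i => hmem _) m x hx
  · obtain ⟨m, rfl⟩ : ∃ k, m = k + 1 := ⟨m - 1, by omega⟩
    rw [hT, hT]
    refine MM_sub hG n (fun i => w (Ψ₁ (FreeGroup.of i))) (fun i => w (Ψ₂ (FreeGroup.of i)))
      (fun i => hmem _) (fun i => hmem _) (fun i k y hy => ?_) (m + 1) x hx
    have hab : Abelianization.of (Ψ₁ (FreeGroup.of i)) = Abelianization.of (Ψ₂ (FreeGroup.of i)) :=
      DFunLike.congr_fun hΨ (Abelianization.of (FreeGroup.of i))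
    have h2 := u_ab hG w hw1 h1 _ _ hab
    rcases k with _ | k
    · have h3 := h2 0 (by omega) y hy
      rw [sub_sub_sub_cancel_right] at h3
      exact (Submodule.mem_bot K).2 h3
    · rw [← projAug_comp (hw0 _), ← projAug_comp (hw0 _)] at h2
      have h3 := van_B hG (hw0 _) (hw0 _) (h1' _) (h1' _) h2 k (k + 1) (by omega) y hy
      change _ ∈ primFil K H k
      rw [primFil_eq, LinearMap.mem_ker, LinearMap.sub_apply, map_sub]
      exact h3

end
end
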